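/- arXiv:0712.2193 — 2 statements merged into one kernel-verified Lean document; each statement's English description precedes it below -/
import Mathlib

section
/- (Corollary 1.4 for X = [0,1].) Let Γ be a cocompact Fuchsian group, let X₀ be the set of harmonic functions h : 𝔻 → ℝ with |h(z)| ≤ 1 for all z ∈ 𝔻, equipped with the topology of uniform convergence on compact subsets of 𝔻, and let Γ act on X₀ by γ·h = h ∘ γ⁻¹. Let Γ act on the closed interval [0,1] by homeomorphisms. Then every continuous Γ-equivariant map F : [0,1] → X₀ (i.e., F(γ·x) = γ·F(x) for all γ ∈ Γ and x ∈ [0,1]) takes values in the set of constant functions: for every x ∈ [0,1] the harmonic function F(x) is constant on 𝔻. -/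
open Metric Set Filter

noncomputable section

/-- The open unit disc in `ℂ`. -/
def unitDisc : Set ℂ := Metric.ball 0 1

/-- A function `f : ℂ → ℝ` is harmonic on a set `U ⊆ ℂ` if, locally on `U`, it is
the real part of a holomorphic function (for open `U` this is equivalent to being
`C²` with vanishing Laplacian). -/
def HarmonicOnSet (f : ℂ → ℝ) (U : Set ℂ) : Prop :=
  ∀ z ∈ U, ∃ r > 0, Metric.ball z r ⊆ U ∧
    ∃ g : ℂ → ℂ, DifferentiableOn ℂ g (Metric.ball z r) ∧
      ∀ w ∈ Metric.ball z r, f w = (g w).re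

/-- `ρ` is a cocompact Fuchsian group action of `Γ` on the open unit disc: a faithful,
properly discontinuous, cocompact action by Möbius transformations
`z ↦ (αz+β)/(β̄z+ᾱ)` with `|α|² - |β|² = 1`. -/
structure IsCocompactFuchsian (Γ : Type*) [Group Γ] (ρ : Γ → ℂ → ℂ) : Prop where
  one_act : ∀ z ∈ unitDisc, ρ 1 z = z
  mul_act : ∀ γ₁ γ₂ : Γ, ∀ z ∈ unitDisc, ρ (γ₁ * γ₂) z = ρ γ₁ (ρ γ₂ z)
  maps_disc : ∀ γ : Γ, ∀ z ∈ unitDisc, ρ γ z ∈ unitDisc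
  moebius : ∀ γ : Γ, ∃ α β : ℂ, ‖α‖ ^ 2 - ‖β‖ ^ 2 = 1 ∧
    ∀ z ∈ unitDisc, ρ γ z = (α * z + β) / ((starRingEnd ℂ) β * z + (starRingEnd ℂ) α)
  faithful : ∀ γ : Γ, (∀ z ∈ unitDisc, ρ γ z = z) → γ = 1
  properly_discontinuous : ∀ K : Set ℂ, K ⊆ unitDisc → IsCompact K →
    {γ : Γ | ((ρ γ '' K) ∩ K).Nonempty}.Finite
  cocompact : ∃ K : Set ℂ, K ⊆ unitDisc ∧ IsCompact K ∧ ∀ z ∈ unitDisc, ∃ γ : Γ, ρ γ z ∈ K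

/-- `σ` is an action of the group `Γ` on the topological space `X` by homeomorphisms. -/
structure IsActionByHomeomorphisms (Γ : Type*) [Group Γ] (X : Type*) [TopologicalSpace X]
    (σ : Γ → X → X) : Prop where
  one_act : ∀ x : X, σ 1 x = x
  mul_act : ∀ γ₁ γ₂ : Γ, ∀ x : X, σ (γ₁ * γ₂) x = σ γ₁ (σ γ₂ x)
  continuous_act : ∀ γ : Γ, Continuous (σ γ)

/-- A continuous function on the unit disc (as a subtype) is harmonic if, locally, it is
the real part of a holomorphic function. -/
def IsHarmonicDiscFun (h : ↥unitDisc → ℝ) : Prop :=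
  ∀ z : ↥unitDisc, ∃ r > 0, Metric.ball (z : ℂ) r ⊆ unitDisc ∧
    ∃ g : ℂ → ℂ, DifferentiableOn ℂ g (Metric.ball (z : ℂ) r) ∧
      ∀ w : ↥unitDisc, (w : ℂ) ∈ Metric.ball (z : ℂ) r → h w = (g (w : ℂ)).re

/-- The space `X₀` of harmonic functions `h : 𝔻 → ℝ` with `|h| ≤ 1`, realized as a subset of
the space `C(𝔻, ℝ)` of continuous functions with the compact-open topology (which, `𝔻` being
locally compact, is the topology of uniform convergence on compact subsets of `𝔻`). -/
def X₀ : Set C(↥unitDisc, ℝ) :=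
  {h | IsHarmonicDiscFun h ∧ ∀ z : ↥unitDisc, |h z| ≤ 1}

/-! ### Harmonic functions on the disc as real parts -/

/-- `v` is the real part of a function holomorphic on the disc. -/
def Harm (v : ℂ → ℝ) : Prop :=
  ∃ H : ℂ → ℂ, DifferentiableOn ℂ H unitDisc ∧ ∀ z ∈ unitDisc, v z = (H z).re

theorem isOpen_unitDisc : IsOpen unitDisc := Metric.isOpen_ball

theorem mem_unitDisc {z : ℂ} : z ∈ unitDisc ↔ ‖z‖ < 1 := by
  simp [unitDisc]

theorem Harm.continuousOn {v : ℂ → ℝ} (h : Harm v) : ContinuousOn v unitDisc := by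
  obtain ⟨H, hH, hv⟩ := h
  exact (Complex.continuous_re.comp_continuousOn hH.continuousOn).congr hv

theorem Harm.add {u v : ℂ → ℝ} (hu : Harm u) (hv : Harm v) : Harm (fun z => u z + v z) := by
  obtain ⟨H, hH, hu⟩ := hu
  obtain ⟨G, hG, hv⟩ := hv
  exact ⟨fun z => H z + G z, hH.add hG, fun z hz => by simp [hu z hz, hv z hz]⟩

theorem Harm.smul {v : ℂ → ℝ} (c : ℝ) (hv : Harm v) : Harm (fun z => c * v z) := by
  obtain ⟨G, hG, hv⟩ := hv
  exact ⟨fun z => (c : ℂ) * G z, hG.const_mul _, fun z hz => by simp [hv z hz]⟩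

theorem Harm.const (c : ℝ) : Harm (fun _ => c) :=
  ⟨fun _ => (c : ℂ), differentiableOn_const _, fun z _ => by simp⟩

theorem Harm.comp {v : ℂ → ℝ} (hv : Harm v) {m : ℂ → ℂ} (hm : DifferentiableOn ℂ m unitDisc)
    (hmaps : MapsTo m unitDisc unitDisc) : Harm (fun z => v (m z)) := by
  obtain ⟨G, hG, hv⟩ := hv
  exact ⟨fun z => G (m z), hG.comp hm hmaps, fun z hz => hv _ (hmaps hz)⟩

theorem Harm.const_of_isLocalMin {v : ℂ → ℝ} (hv : Harm v) {z₀ : ℂ} (hz₀ : z₀ ∈ unitDisc)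
    (hmin : ∀ᶠ z in nhds z₀, v z₀ ≤ v z) : ∀ z ∈ unitDisc, v z = v z₀ := by
  obtain ⟨H, hH, hv⟩ := hv
  have hnorm : ∀ z, z ∈ unitDisc → ‖Complex.exp (-H z)‖ = Real.exp (-v z) := by
    intro z hz
    rw [Complex.norm_exp, hv z hz]; simp
  have hE : DifferentiableOn ℂ (fun z => Complex.exp (-H z)) unitDisc := hH.neg.cexp
  have hA := hE.analyticOnNhd isOpen_unitDisc
  have hev : ∀ᶠ z in nhds z₀, Complex.exp (-H z) = Complex.exp (-H z₀) := by
    apply Complex.eventually_eq_of_isLocalMax_norm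
    · filter_upwards [isOpen_unitDisc.mem_nhds hz₀] with z hz
      exact hE.differentiableAt (isOpen_unitDisc.mem_nhds hz)
    · filter_upwards [isOpen_unitDisc.mem_nhds hz₀, hmin] with z hz hz'
      simp only [Function.comp]
      rw [hnorm z hz, hnorm z₀ hz₀]
      exact Real.exp_le_exp.2 (by linarith)
  have hpre : IsPreconnected unitDisc := (convex_ball (0:ℂ) 1).isPreconnected
  have := hA.eqOn_of_preconnected_of_eventuallyEq (analyticOnNhd_const (v := Complex.exp (-H z₀)))
    hpre hz₀ hev
  intro z hz
  have h1 := congrArg norm (this hz)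
  simp only at h1
  rw [hnorm z hz, hnorm z₀ hz₀] at h1
  have := Real.exp_injective h1
  linarith

theorem Harm.circle {v : ℂ → ℝ} (hv : Harm v) {r : ℝ} (hr0 : 0 ≤ r) (hr : r < 1) :
    Real.circleAverage v 0 r = v 0 := by
  have h0 : (0:ℂ) ∈ unitDisc := by simp [mem_unitDisc]
  obtain ⟨H, hH, hv⟩ := hv
  have : InnerProductSpace.HarmonicOnNhd (fun z => (H z).re) (closedBall 0 |r|) := by
    intro z hz
    apply AnalyticAt.harmonicAt_re
    apply hH.analyticOnNhd isOpen_unitDisc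
    rw [mem_unitDisc]
    rw [abs_of_nonneg hr0] at hz
    simp at hz
    linarith
  rw [hv 0 h0, ← this.circleAverage_eq]
  apply Real.circleAverage_congr_sphere
  intro z hz
  apply hv
  rw [mem_unitDisc]
  simp [abs_of_nonneg hr0] at hz
  linarith

theorem harm_of_isHarmonicDiscFun {h : ↥unitDisc → ℝ} (hh : IsHarmonicDiscFun h)
    {v : ℂ → ℝ} (hv : ∀ z : ↥unitDisc, v z = h z) : Harm v := by
  have : InnerProductSpace.HarmonicOnNhd v (ball 0 1) := by
    intro z hz
    obtain ⟨r, hr, hsub, g, hg, hgw⟩ := hh ⟨z, hz⟩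
    have h1 : v =ᶠ[nhds z] fun w => (g w).re := by
      filter_upwards [Metric.ball_mem_nhds z hr] with w hw
      rw [← hgw ⟨w, hsub hw⟩ hw, ← hv]
    rw [InnerProductSpace.harmonicAt_congr_nhds h1]
    apply AnalyticAt.harmonicAt_re
    exact hg.analyticOnNhd Metric.isOpen_ball z (Metric.mem_ball_self hr)
  obtain ⟨H, hH, hHv⟩ := this.exists_analyticOnNhd_ball_re_eq
  exact ⟨H, fun z hz => (hH z hz).differentiableAt.differentiableWithinAt,
    fun z hz => (hHv hz).symm⟩

/-! ### Möbius maps -/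

/-- The Möbius map with coefficients `α, β`. -/
def moeb (α β : ℂ) (z : ℂ) : ℂ :=
  (α * z + β) / ((starRingEnd ℂ) β * z + (starRingEnd ℂ) α)

theorem moeb_den_ne {α β : ℂ} (h : ‖α‖ ^ 2 - ‖β‖ ^ 2 = 1) {z : ℂ} (hz : z ∈ unitDisc) :
    (starRingEnd ℂ) β * z + (starRingEnd ℂ) α ≠ 0 := by
  intro h0
  rw [mem_unitDisc] at hz
  have h1 : ‖α‖ = ‖β‖ * ‖z‖ := by
    have : (starRingEnd ℂ) α = - ((starRingEnd ℂ) β * z) := by linear_combination h0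
    have := congrArg norm this
    simpa using this
  have : ‖α‖ ≤ ‖β‖ := by
    rw [h1]; exact mul_le_of_le_one_right (norm_nonneg _) hz.le
  nlinarith [norm_nonneg α, norm_nonneg β]

theorem moeb_hyp {α β : ℂ} (h : ‖α‖ ^ 2 - ‖β‖ ^ 2 = 1) :
    α * (starRingEnd ℂ) α - β * (starRingEnd ℂ) β = 1 := by
  rw [Complex.mul_conj, Complex.mul_conj, Complex.normSq_eq_norm_sq, Complex.normSq_eq_norm_sq]
  exact_mod_cast h

theorem moeb_one_sub {α β : ℂ} (h : ‖α‖ ^ 2 - ‖β‖ ^ 2 = 1) {z : ℂ} (hz : z ∈ unitDisc) :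
    1 - ‖moeb α β z‖ ^ 2 =
      (1 - ‖z‖ ^ 2) / ‖(starRingEnd ℂ) β * z + (starRingEnd ℂ) α‖ ^ 2 := by
  have hne := moeb_den_ne h hz
  have hne' : ‖(starRingEnd ℂ) β * z + (starRingEnd ℂ) α‖ ^ 2 ≠ 0 := by
    simpa using hne
  rw [eq_div_iff hne', moeb, norm_div, div_pow, sub_mul, div_mul_cancel₀ _ hne']
  have key : ∀ w : ℂ, ((‖w‖ ^ 2 : ℝ) : ℂ) = w * (starRingEnd ℂ) w := by
    intro w; rw [Complex.mul_conj, Complex.normSq_eq_norm_sq]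
  have hh := moeb_hyp h
  apply Complex.ofReal_injective
  simp only [Complex.ofReal_sub, Complex.ofReal_mul, key, Complex.ofReal_one, map_add, map_mul,
    Complex.conj_conj]
  linear_combination (1 - z * (starRingEnd ℂ) z) * hh

theorem moeb_mapsTo {α β : ℂ} (h : ‖α‖ ^ 2 - ‖β‖ ^ 2 = 1) :
    MapsTo (moeb α β) unitDisc unitDisc := by
  intro z hz
  have h1 := moeb_one_sub h hz
  have hne := moeb_den_ne h hz
  have hz' := mem_unitDisc.1 hz
  have : 0 < 1 - ‖moeb α β z‖ ^ 2 := by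
    rw [h1]
    have : 0 < 1 - ‖z‖ ^ 2 := by nlinarith [norm_nonneg z]
    positivity
  rw [mem_unitDisc]
  nlinarith [norm_nonneg (moeb α β z)]

theorem moeb_sub {α β : ℂ} (h : ‖α‖ ^ 2 - ‖β‖ ^ 2 = 1) {z w : ℂ} (hz : z ∈ unitDisc)
    (hw : w ∈ unitDisc) : moeb α β z - moeb α β w = (z - w) /
      (((starRingEnd ℂ) β * z + (starRingEnd ℂ) α) *
        ((starRingEnd ℂ) β * w + (starRingEnd ℂ) α)) := by
  have hne := moeb_den_ne h hz
  have hne' := moeb_den_ne h hw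
  have hh := moeb_hyp h
  rw [moeb, moeb, div_sub_div _ _ hne hne']
  congr 1
  linear_combination (z - w) * hh

theorem moeb_hasDerivAt {α β : ℂ} (h : ‖α‖ ^ 2 - ‖β‖ ^ 2 = 1) {z : ℂ} (hz : z ∈ unitDisc) :
    HasDerivAt (moeb α β) (1 / ((starRingEnd ℂ) β * z + (starRingEnd ℂ) α) ^ 2) z := by
  have hne := moeb_den_ne h hz
  have hh := moeb_hyp h
  have h1 : HasDerivAt (fun z : ℂ => α * z + β) α z := by
    simpa using ((hasDerivAt_id z).const_mul α).add_const β
  have h2 : HasDerivAt (fun z : ℂ => (starRingEnd ℂ) β * z + (starRingEnd ℂ) α)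
      ((starRingEnd ℂ) β) z := by
    simpa using ((hasDerivAt_id z).const_mul ((starRingEnd ℂ) β)).add_const ((starRingEnd ℂ) α)
  have h3 := h1.div h2 hne
  have h4 : α * ((starRingEnd ℂ) β * z + (starRingEnd ℂ) α) - (α * z + β) * (starRingEnd ℂ) β
      = 1 := by linear_combination hh
  rw [h4] at h3
  exact h3

theorem moeb_inv_hyp {α β : ℂ} (h : ‖α‖ ^ 2 - ‖β‖ ^ 2 = 1) :
    ‖(starRingEnd ℂ) α‖ ^ 2 - ‖-β‖ ^ 2 = 1 := by simpa using h

theorem moeb_moeb_inv {α β : ℂ} (h : ‖α‖ ^ 2 - ‖β‖ ^ 2 = 1) {z : ℂ} (hz : z ∈ unitDisc) :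
    moeb α β (moeb ((starRingEnd ℂ) α) (-β) z) = z := by
  have hne := moeb_den_ne (moeb_inv_hyp h) hz
  have hne2 := moeb_den_ne h (moeb_mapsTo (moeb_inv_hyp h) hz)
  have hh := moeb_hyp h
  rw [moeb, div_eq_iff hne2]
  rw [moeb] at hne2 ⊢
  set d := (starRingEnd ℂ) (-β) * z + (starRingEnd ℂ) ((starRingEnd ℂ) α) with hd
  have hd' : d = -(starRingEnd ℂ) β * z + α := by rw [hd]; simp
  field_simp
  rw [hd']
  ring

theorem moeb_image {α β : ℂ} (h : ‖α‖ ^ 2 - ‖β‖ ^ 2 = 1) : moeb α β '' unitDisc = unitDisc := by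
  apply Subset.antisymm
  · exact (moeb_mapsTo h).image_subset
  · intro z hz
    exact ⟨_, moeb_mapsTo (moeb_inv_hyp h) hz, moeb_moeb_inv h hz⟩

theorem moeb_injOn {α β : ℂ} (h : ‖α‖ ^ 2 - ‖β‖ ^ 2 = 1) : InjOn (moeb α β) unitDisc := by
  intro z hz w hw hzw
  have h1 := moeb_sub h hz hw
  rw [hzw, sub_self, eq_comm, div_eq_zero_iff] at h1
  rcases h1 with h1 | h1
  · exact sub_eq_zero.1 h1
  · exact absurd h1 (mul_ne_zero (moeb_den_ne h hz) (moeb_den_ne h hw))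

theorem moeb_measurable (α β : ℂ) : Measurable (moeb α β) := by
  unfold moeb; fun_prop

theorem moeb_differentiableOn {α β : ℂ} (h : ‖α‖ ^ 2 - ‖β‖ ^ 2 = 1) :
    DifferentiableOn ℂ (moeb α β) unitDisc := fun _ hz =>
  (moeb_hasDerivAt h hz).differentiableAt.differentiableWithinAt

theorem exists_moeb_zero {z : ℂ} (hz : z ∈ unitDisc) :
    ∃ α β : ℂ, ‖α‖ ^ 2 - ‖β‖ ^ 2 = 1 ∧ moeb α β 0 = z := by
  rw [mem_unitDisc] at hz
  have hp : 0 < 1 - ‖z‖ ^ 2 := by nlinarith [norm_nonneg z]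
  have hs := Real.sq_sqrt hp.le
  have hs0 := Real.sqrt_pos.2 hp
  set s := Real.sqrt (1 - ‖z‖ ^ 2)
  refine ⟨((1 / s : ℝ) : ℂ), ((1 / s : ℝ) : ℂ) * z, ?_, ?_⟩
  · rw [norm_mul, Complex.norm_real, Real.norm_of_nonneg (by positivity)]
    field_simp
    linarith
  · have : (s : ℂ) ≠ 0 := by exact_mod_cast hs0.ne'
    simp only [moeb, mul_zero, zero_add, Complex.conj_ofReal]
    push_cast
    field_simp

/-- An invariant pseudo-distance on the disc. -/
def pdist (z w : ℂ) : ℝ := ‖z - w‖ ^ 2 / ((1 - ‖z‖ ^ 2) * (1 - ‖w‖ ^ 2))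

theorem pdist_comm (z w : ℂ) : pdist z w = pdist w z := by
  rw [pdist, pdist, norm_sub_rev, mul_comm]

theorem pdist_moeb {α β : ℂ} (h : ‖α‖ ^ 2 - ‖β‖ ^ 2 = 1) {z w : ℂ} (hz : z ∈ unitDisc)
    (hw : w ∈ unitDisc) : pdist (moeb α β z) (moeb α β w) = pdist z w := by
  have hne := moeb_den_ne h hz
  have hne' := moeb_den_ne h hw
  have hz' := mem_unitDisc.1 hz
  have hw' := mem_unitDisc.1 hw
  have hp : 0 < 1 - ‖z‖ ^ 2 := by nlinarith [norm_nonneg z]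
  have hq : 0 < 1 - ‖w‖ ^ 2 := by nlinarith [norm_nonneg w]
  rw [pdist, pdist, moeb_one_sub h hz, moeb_one_sub h hw, moeb_sub h hz hw, norm_div, norm_mul]
  rw [← norm_ne_zero_iff] at hne hne'
  generalize ‖(starRingEnd ℂ) β * z + (starRingEnd ℂ) α‖ = x at *
  generalize ‖(starRingEnd ℂ) β * w + (starRingEnd ℂ) α‖ = y at *
  field_simp

/-! ### The hyperbolic measure -/

/-- Density of the hyperbolic measure. -/
def dens (z : ℂ) : ENNReal := ENNReal.ofReal (1 / (1 - ‖z‖ ^ 2) ^ 2)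

/-- The hyperbolic measure on the disc. -/
def hyp : MeasureTheory.Measure ℂ :=
  (MeasureTheory.volume.restrict unitDisc).withDensity dens

theorem dens_measurable : Measurable dens := by unfold dens; fun_prop

instance : MeasureTheory.SFinite hyp := by unfold hyp; infer_instance

open MeasureTheory in
theorem lintegral_hyp (f : ℂ → ENNReal) :
    ∫⁻ z, f z ∂hyp = ∫⁻ z in unitDisc, dens z * f z := by
  unfold hyp
  rw [lintegral_withDensity_eq_lintegral_mul_non_measurable _ dens_measurable]
  · rfl
  · exact Eventually.of_forall fun z => ENNReal.ofReal_lt_top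

open MeasureTheory in
theorem hyp_congr {f g : ℂ → ENNReal} (h : ∀ z ∈ unitDisc, f z = g z) :
    ∫⁻ z, f z ∂hyp = ∫⁻ z, g z ∂hyp := by
  rw [lintegral_hyp, lintegral_hyp]
  exact setLIntegral_congr_fun isOpen_unitDisc.measurableSet fun z hz => by simp only [h z hz]

open MeasureTheory in
theorem ae_hyp_mem : ∀ᵐ z ∂hyp, z ∈ unitDisc := by
  have h : hyp ≪ volume.restrict unitDisc := withDensity_absolutelyContinuous _ _
  exact h.ae_le (ae_restrict_mem isOpen_unitDisc.measurableSet)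

open MeasureTheory in
theorem restrict_ac_hyp : volume.restrict unitDisc ≪ hyp := by
  apply withDensity_absolutelyContinuous' dens_measurable.aemeasurable
  filter_upwards [ae_restrict_mem isOpen_unitDisc.measurableSet] with z hz
  have hz' := mem_unitDisc.1 hz
  have hp : 0 < 1 - ‖z‖ ^ 2 := by nlinarith [norm_nonneg z]
  have : 0 < 1 / (1 - ‖z‖ ^ 2) ^ 2 := by positivity
  simp only [dens, ne_eq, ENNReal.ofReal_eq_zero, not_le]
  exact this

open MeasureTheory in
theorem hyp_moeb {α β : ℂ} (h : ‖α‖ ^ 2 - ‖β‖ ^ 2 = 1) (f : ℂ → ENNReal) :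
    ∫⁻ z, f (moeb α β z) ∂hyp = ∫⁻ z, f z ∂hyp := by
  rw [lintegral_hyp, lintegral_hyp]
  conv_rhs => rw [← moeb_image h]
  have hd : ∀ z ∈ unitDisc, HasFDerivWithinAt (moeb α β)
      (((ContinuousLinearMap.toSpanSingleton ℂ
        (1 / ((starRingEnd ℂ) β * z + (starRingEnd ℂ) α) ^ 2) : ℂ →L[ℂ] ℂ)).restrictScalars ℝ)
      unitDisc z := fun z hz =>
    ((moeb_hasDerivAt h hz).hasFDerivAt.restrictScalars ℝ).hasFDerivWithinAt
  rw [lintegral_image_eq_lintegral_abs_det_fderiv_mul volume isOpen_unitDisc.measurableSet hd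
    (moeb_injOn h)]
  apply setLIntegral_congr_fun isOpen_unitDisc.measurableSet
  intro z hz
  simp only
  rw [← mul_assoc]
  congr 1
  have hz' := mem_unitDisc.1 hz
  have hp : 0 < 1 - ‖z‖ ^ 2 := by nlinarith [norm_nonneg z]
  have hne := moeb_den_ne h hz
  rw [dens, dens, moeb_one_sub h hz, ← ENNReal.ofReal_mul (abs_nonneg _)]
  congr 1
  have hdet : (((ContinuousLinearMap.toSpanSingleton ℂ
        (1 / ((starRingEnd ℂ) β * z + (starRingEnd ℂ) α) ^ 2) : ℂ →L[ℂ] ℂ)).restrictScalars ℝ).det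
      = 1 / (‖(starRingEnd ℂ) β * z + (starRingEnd ℂ) α‖ ^ 2) ^ 2 := by
    simp [ContinuousLinearMap.det, LinearMap.det_restrictScalars, Algebra.norm_complex_apply, Complex.normSq_eq_norm_sq]
  rw [hdet, abs_of_nonneg (by positivity)]
  rw [← norm_ne_zero_iff] at hne
  field_simp

/-- The averaging kernel. -/
def pk (z w : ℂ) : ENNReal := if pdist z w < 1 then 1 else 0

theorem pk_comm (z w : ℂ) : pk z w = pk w z := by rw [pk, pk, pdist_comm]

theorem pk_measurable : Measurable (fun q : ℂ × ℂ => pk q.1 q.2) := by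
  unfold pk
  refine Measurable.ite (measurableSet_lt ?_ measurable_const) measurable_const measurable_const
  unfold pdist
  fun_prop

theorem pk_moeb {α β : ℂ} (h : ‖α‖ ^ 2 - ‖β‖ ^ 2 = 1) {z w : ℂ} (hz : z ∈ unitDisc)
    (hw : w ∈ unitDisc) : pk (moeb α β z) (moeb α β w) = pk z w := by
  rw [pk, pk, pdist_moeb h hz hw]

open MeasureTheory in
theorem hyp_compact_lt_top {K : Set ℂ} (hK : IsCompact K) (hKD : K ⊆ unitDisc) : hyp K < ⊤ := by
  obtain ⟨R, hR0, hR1, hKR⟩ : ∃ R : ℝ, 0 ≤ R ∧ R < 1 ∧ ∀ z ∈ K, ‖z‖ ≤ R := by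
    rcases K.eq_empty_or_nonempty with rfl | hne
    · exact ⟨0, le_rfl, one_pos, by simp⟩
    · obtain ⟨z, hz, hmax⟩ := hK.exists_isMaxOn hne continuous_norm.continuousOn
      exact ⟨‖z‖, norm_nonneg z, mem_unitDisc.1 (hKD hz), fun w hw => hmax hw⟩
  unfold hyp
  rw [withDensity_apply _ hK.measurableSet, Measure.restrict_restrict hK.measurableSet,
    inter_eq_left.2 hKD]
  calc ∫⁻ a in K, dens a ≤ ∫⁻ a in K, ENNReal.ofReal (1 / (1 - R ^ 2) ^ 2) := by
        apply setLIntegral_mono measurable_const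
        intro z hz
        apply ENNReal.ofReal_le_ofReal
        have := hKR z hz
        have h1 : 0 < 1 - R ^ 2 := by nlinarith
        have h2 : 1 - R ^ 2 ≤ 1 - ‖z‖ ^ 2 := by nlinarith [norm_nonneg z]
        gcongr
    _ = ENNReal.ofReal (1 / (1 - R ^ 2) ^ 2) * volume K := by simp
    _ < ⊤ := ENNReal.mul_lt_top ENNReal.ofReal_lt_top hK.measure_lt_top

/-- Mass of the averaging kernel. -/
def massC : ENNReal := ∫⁻ w, pk 0 w ∂hyp

open MeasureTheory in
theorem massC_lt_top : massC < ⊤ := by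
  have hsub : closedBall (0:ℂ) (3/4) ⊆ unitDisc := by
    intro z hz
    simp at hz
    rw [mem_unitDisc]; linarith
  have h1 := hyp_compact_lt_top (isCompact_closedBall (0:ℂ) (3/4)) hsub
  refine lt_of_le_of_lt ?_ h1
  rw [massC, ← lintegral_indicator_one measurableSet_closedBall]
  apply lintegral_mono_ae
  filter_upwards [ae_hyp_mem] with z hz
  by_cases hp : pdist 0 z < 1
  · have : z ∈ closedBall (0:ℂ) (3/4) := by
      have hz' := mem_unitDisc.1 hz
      have hp' : 0 < 1 - ‖z‖ ^ 2 := by nlinarith [norm_nonneg z]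
      simp only [pdist, zero_sub, norm_neg, norm_zero] at hp
      rw [div_lt_one (by simpa using hp')] at hp
      simp
      nlinarith [norm_nonneg z]
    simp [pk, hp, this]
  · simp [pk, hp]

open MeasureTheory in
theorem hyp_rot (g : ℂ → ENNReal) (θ : ℝ) :
    ∫⁻ w, g (Complex.exp (θ * Complex.I) * w) ∂hyp = ∫⁻ w, g w ∂hyp := by
  have hα : ‖Complex.exp ((θ / 2 : ℝ) * Complex.I)‖ ^ 2 - ‖(0:ℂ)‖ ^ 2 = 1 := by
    rw [Complex.norm_exp_ofReal_mul_I]; simp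
  rw [← hyp_moeb hα g]
  congr 1
  ext w
  congr 1
  simp only [moeb, map_zero, zero_mul, zero_add, add_zero, ← Complex.exp_conj, map_mul,
    Complex.conj_I, Complex.conj_ofReal]
  rw [mul_div_right_comm, ← Complex.exp_sub]
  congr 2
  push_cast
  ring

theorem rot_mem {w : ℂ} (hw : w ∈ unitDisc) (θ : ℝ) :
    Complex.exp (θ * Complex.I) * w ∈ unitDisc := by
  have hw' := mem_unitDisc.1 hw
  rw [mem_unitDisc, norm_mul, Complex.norm_exp_ofReal_mul_I, one_mul]
  exact hw'

open MeasureTheory in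
theorem circle_rot {v : ℂ → ℝ} (hv : Harm v) {w : ℂ} (hw : w ∈ unitDisc) :
    ∫ θ in (0:ℝ)..(2 * Real.pi), v (Complex.exp (θ * Complex.I) * w) = 2 * Real.pi * v 0 := by
  have hw' := mem_unitDisc.1 hw
  obtain ⟨u, hun, hwu⟩ : ∃ u : ℂ, ‖u‖ = 1 ∧ w = ‖w‖ * u :=
    ⟨Complex.exp (Complex.arg w * Complex.I), Complex.norm_exp_ofReal_mul_I _,
      (Complex.norm_mul_exp_arg_mul_I w).symm⟩
  have hv' : Harm (fun ζ => v (u * ζ)) := by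
    apply hv.comp (m := fun ζ => u * ζ) (by fun_prop)
    intro z hz
    rw [mem_unitDisc, norm_mul, hun, one_mul]
    exact mem_unitDisc.1 hz
  have := hv'.circle (norm_nonneg w) hw'
  rw [Real.circleAverage_def] at this
  simp only [circleMap_zero, mul_zero, smul_eq_mul] at this
  rw [← this, ← mul_assoc, mul_inv_cancel₀ (by positivity), one_mul]
  congr 1
  ext θ
  congr 1
  conv_lhs => rw [hwu]
  ring

open MeasureTheory in
theorem circle_rot_lintegral {v : ℂ → ℝ} (hv : Harm v) (hv0 : ∀ z ∈ unitDisc, 0 ≤ v z)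
    {w : ℂ} (hw : w ∈ unitDisc) :
    ∫⁻ θ in Ioc 0 (2 * Real.pi), ENNReal.ofReal (v (Complex.exp ((θ:ℝ) * Complex.I) * w))
      = ENNReal.ofReal (2 * Real.pi) * ENNReal.ofReal (v 0) := by
  have hcont : Continuous fun θ : ℝ => v (Complex.exp ((θ:ℝ) * Complex.I) * w) :=
    hv.continuousOn.comp_continuous (by fun_prop) (rot_mem hw)
  rw [← ofReal_integral_eq_lintegral_ofReal hcont.integrableOn_Ioc
    (Eventually.of_forall fun θ => hv0 _ (rot_mem hw θ)),
    ← intervalIntegral.integral_of_le (by positivity), circle_rot hv hw,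
    ENNReal.ofReal_mul (by positivity)]

theorem pdist_left_measurable (z : ℂ) : Measurable (fun w => pdist z w) := by
  unfold pdist
  fun_prop

theorem pk_left_measurable (z : ℂ) : Measurable (fun w => pk z w) :=
  Measurable.ite (measurableSet_lt (pdist_left_measurable z) measurable_const)
    measurable_const measurable_const

theorem pk_zero_measurable : Measurable (fun w => pk 0 w) := pk_left_measurable 0

open MeasureTheory in
theorem mean_zero {v : ℂ → ℝ} (hv : Harm v) (hvm : Measurable v) (hv0 : ∀ z ∈ unitDisc, 0 ≤ v z) :
    ∫⁻ w, pk 0 w * ENNReal.ofReal (v w) ∂hyp = massC * ENNReal.ofReal (v 0) := by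
  obtain ⟨g, hg⟩ : ∃ g : ℂ → ENNReal, g = fun w => pk 0 w * ENNReal.ofReal (v w) := ⟨_, rfl⟩
  have hgm : Measurable g := by
    rw [hg]; exact pk_zero_measurable.mul hvm.ennreal_ofReal
  have hin : ∀ w ∈ unitDisc, ∫⁻ θ in Ioc 0 (2 * Real.pi), g (Complex.exp ((θ:ℝ) * Complex.I) * w)
      = ENNReal.ofReal (2 * Real.pi) * (pk 0 w * ENNReal.ofReal (v 0)) := by
    intro w hw
    have hpkr : ∀ θ : ℝ, pk 0 (Complex.exp ((θ:ℝ) * Complex.I) * w) = pk 0 w := by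
      intro θ
      simp [pk, pdist, Complex.norm_exp_ofReal_mul_I]
    have hm1 : Measurable fun θ : ℝ => ENNReal.ofReal (v (Complex.exp ((θ:ℝ) * Complex.I) * w)) :=
      (hvm.comp (by fun_prop)).ennreal_ofReal
    simp only [hg, hpkr]
    rw [lintegral_const_mul _ hm1, circle_rot_lintegral hv hv0 hw, mul_left_comm]
  have h2pi : ENNReal.ofReal (2 * Real.pi) ≠ 0 := by
    simp [Real.pi_pos]
  have hsw : ∫⁻ (θ : ℝ) in Ioc 0 (2 * Real.pi), ∫⁻ w, g (Complex.exp ((θ:ℝ) * Complex.I) * w) ∂hyp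
      = ∫⁻ w, (∫⁻ θ in Ioc 0 (2 * Real.pi), g (Complex.exp ((θ:ℝ) * Complex.I) * w)) ∂hyp := by
    rw [lintegral_lintegral_swap]
    apply Measurable.aemeasurable
    refine hgm.comp (g := g) (f := fun p : ℝ × ℂ => Complex.exp ((p.1:ℝ) * Complex.I) * p.2) ?_
    fun_prop
  have key : ENNReal.ofReal (2 * Real.pi) * ∫⁻ w, g w ∂hyp =
      ENNReal.ofReal (2 * Real.pi) * (massC * ENNReal.ofReal (v 0)) := by
    have h1 : ENNReal.ofReal (2 * Real.pi) * ∫⁻ w, g w ∂hyp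
        = ∫⁻ (θ : ℝ) in Ioc 0 (2 * Real.pi), ∫⁻ w, g (Complex.exp ((θ:ℝ) * Complex.I) * w) ∂hyp := by
      simp only [hyp_rot]
      rw [setLIntegral_const, Real.volume_Ioc, sub_zero, mul_comm]
    rw [h1, hsw, hyp_congr hin, lintegral_const_mul _ (pk_zero_measurable.mul_const _),
      lintegral_mul_const _ pk_zero_measurable, massC]
  rw [hg] at key
  exact (ENNReal.mul_right_inj h2pi ENNReal.ofReal_ne_top).1 key

open MeasureTheory in
theorem mean_value {v : ℂ → ℝ} (hv : Harm v) (hvm : Measurable v)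
    (hv0 : ∀ z ∈ unitDisc, 0 ≤ v z) {z : ℂ} (hz : z ∈ unitDisc) :
    ∫⁻ w, pk z w * ENNReal.ofReal (v w) ∂hyp = massC * ENNReal.ofReal (v z) := by
  obtain ⟨α, β, h, hm⟩ := exists_moeb_zero hz
  rw [← hyp_moeb h]
  have h0 : (0:ℂ) ∈ unitDisc := by simp [mem_unitDisc]
  have h1 := mean_zero (hv.comp (moeb_differentiableOn h) (moeb_mapsTo h))
    (hvm.comp (moeb_measurable α β)) (fun z hz => hv0 _ (moeb_mapsTo h hz))
  rw [hm] at h1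
  rw [← h1]
  apply hyp_congr
  intro w hw
  rw [← pk_moeb h h0 hw, hm]

/-! ### Mass transport -/

theorem countable_of_fuchsian {Γ : Type*} [Group Γ] {ρ : Γ → ℂ → ℂ}
    (hΓ : IsCocompactFuchsian Γ ρ) : Countable Γ := by
  have h0 : (0:ℂ) ∈ unitDisc := by simp [mem_unitDisc]
  have hsub : ∀ n : ℕ, closedBall (0:ℂ) (1 - 1 / ((n:ℝ) + 1)) ⊆ unitDisc := by
    intro n z hz
    have : 0 < 1 / ((n:ℝ) + 1) := by positivity
    rw [mem_closedBall_zero_iff] at hz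
    rw [mem_unitDisc]; linarith
  have hun : (⋃ n : ℕ, {γ : Γ | ((ρ γ '' closedBall (0:ℂ) (1 - 1 / ((n:ℝ) + 1))) ∩
      closedBall (0:ℂ) (1 - 1 / ((n:ℝ) + 1))).Nonempty}) = univ := by
    apply eq_univ_of_forall
    intro γ
    have h1 := mem_unitDisc.1 (hΓ.maps_disc γ 0 h0)
    obtain ⟨n, hn⟩ := exists_nat_one_div_lt (sub_pos.2 h1)
    refine mem_iUnion.2 ⟨n, ρ γ 0, ⟨0, ?_, rfl⟩, ?_⟩
    · rw [mem_closedBall_zero_iff, norm_zero]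
      linarith [norm_nonneg (ρ γ 0)]
    · rw [mem_closedBall_zero_iff]
      linarith
  rw [← Set.countable_univ_iff, ← hun]
  exact countable_iUnion fun n =>
    (hΓ.properly_discontinuous _ (hsub n) (isCompact_closedBall _ _)).countable

open MeasureTheory in
theorem exists_weight {Γ : Type*} [Group Γ] {ρ : Γ → ℂ → ℂ} (hΓ : IsCocompactFuchsian Γ ρ) :
    ∃ ψ : ℂ → ENNReal, Measurable ψ ∧ ∫⁻ z, ψ z ∂hyp ≠ ⊤ ∧
      ∀ z ∈ unitDisc, ∑' γ : Γ, ψ (ρ γ z) = 1 := by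
  have := countable_of_fuchsian hΓ
  choose α β hαβ hm using hΓ.moebius
  obtain ⟨K, hKD, hK, hcov⟩ := hΓ.cocompact
  have hm' : ∀ γ, ∀ z ∈ unitDisc, ρ γ z = moeb (α γ) (β γ) z := hm
  obtain ⟨N, hN⟩ : ∃ N : ℂ → ENNReal, N = fun z =>
    ∑' γ : Γ, K.indicator 1 (moeb (α γ) (β γ) z) := ⟨_, rfl⟩
  have hind : Measurable (K.indicator (1 : ℂ → ENNReal)) :=
    measurable_one.indicator hK.measurableSet
  have hNm : Measurable N := by
    rw [hN]
    exact Measurable.tsum fun γ => hind.comp (moeb_measurable _ _)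
  have hNρ : ∀ z ∈ unitDisc, N z = ∑' γ : Γ, K.indicator 1 (ρ γ z) := by
    intro z hz
    rw [hN]
    exact tsum_congr fun γ => by rw [hm' γ z hz]
  have hN1 : ∀ z ∈ unitDisc, 1 ≤ N z := by
    intro z hz
    obtain ⟨γ, hγ⟩ := hcov z hz
    rw [hNρ z hz]
    refine le_trans ?_ (ENNReal.le_tsum γ)
    simp [hγ]
  have hNtop : ∀ z ∈ unitDisc, N z ≠ ⊤ := by
    intro z hz
    rw [hNρ z hz]
    have hfin := hΓ.properly_discontinuous (insert z K) (insert_subset hz hKD) (hK.insert z)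
    rw [tsum_eq_sum (s := hfin.toFinset)]
    · apply (ENNReal.sum_lt_top.2 _).ne
      intro γ _
      by_cases h : ρ γ z ∈ K <;> simp [h]
    · intro γ hγ
      by_contra hne
      apply hγ
      rw [Set.Finite.mem_toFinset]
      have : ρ γ z ∈ K := by
        by_contra h
        exact hne (by simp [h])
      exact ⟨ρ γ z, ⟨z, mem_insert _ _, rfl⟩, mem_insert_of_mem _ this⟩
  have hNinv : ∀ γ, ∀ z ∈ unitDisc, N (ρ γ z) = N z := by
    intro γ z hz
    rw [hNρ z hz, hNρ _ (hΓ.maps_disc γ z hz),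
      ← (Equiv.mulRight γ).tsum_eq fun δ : Γ => K.indicator (1 : ℂ → ENNReal) (ρ δ z)]
    apply tsum_congr
    intro δ
    rw [Equiv.coe_mulRight, hΓ.mul_act δ γ z hz]
  refine ⟨fun z => K.indicator 1 z / N z, hind.div hNm, ?_, ?_⟩
  · apply ne_of_lt
    refine lt_of_le_of_lt ?_ (hyp_compact_lt_top hK hKD)
    rw [← lintegral_indicator_one hK.measurableSet]
    apply lintegral_mono_ae
    filter_upwards [ae_hyp_mem] with z hz
    exact ENNReal.div_le_of_le_mul (le_mul_of_one_le_right' (hN1 z hz))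
  · intro z hz
    simp only [hNinv _ z hz, div_eq_mul_inv]
    rw [ENNReal.tsum_mul_right, ← hNρ z hz]
    exact ENNReal.mul_inv_cancel (zero_lt_one.trans_le (hN1 z hz)).ne' (hNtop z hz)

open MeasureTheory in
theorem hyp_act {Γ : Type*} [Group Γ] {ρ : Γ → ℂ → ℂ} (hΓ : IsCocompactFuchsian Γ ρ) (γ : Γ)
    (f : ℂ → ENNReal) : ∫⁻ z, f (ρ γ z) ∂hyp = ∫⁻ z, f z ∂hyp := by
  obtain ⟨α, β, h, hm⟩ := hΓ.moebius γ
  rw [← hyp_moeb h f]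
  apply hyp_congr
  intro z hz
  rw [hm z hz]; rfl

open MeasureTheory in
theorem mass_transport {Γ : Type*} [Group Γ] {ρ : Γ → ℂ → ℂ} (hΓ : IsCocompactFuchsian Γ ρ)
    {ψ : ℂ → ENNReal} (hψm : Measurable ψ) (hψ : ∀ z ∈ unitDisc, ∑' γ : Γ, ψ (ρ γ z) = 1)
    {k : ℂ → ℂ → ENNReal} (hk : Measurable fun q : ℂ × ℂ => k q.1 q.2)
    (hinv : ∀ γ, ∀ z ∈ unitDisc, ∀ w ∈ unitDisc, k (ρ γ z) (ρ γ w) = k z w) :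
    ∫⁻ z, ψ z * ∫⁻ w, k z w ∂hyp ∂hyp = ∫⁻ z, ψ z * ∫⁻ w, k w z ∂hyp ∂hyp := by
  have := countable_of_fuchsian hΓ
  choose α β hαβ hm using hΓ.moebius
  have hm' : ∀ γ, ∀ z ∈ unitDisc, ρ γ z = moeb (α γ) (β γ) z := hm
  have hkz : ∀ z, Measurable (fun w => k z w) := fun z => by
    have h : Measurable (fun w : ℂ => (z, w)) := measurable_prodMk_left
    exact hk.comp h
  have hkw : ∀ w, Measurable (fun z => k z w) := fun w => by
    have h : Measurable (fun z : ℂ => (z, w)) := measurable_prodMk_right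
    exact hk.comp h
  have hψγ : ∀ γ, Measurable fun w => ψ (moeb (α γ) (β γ) w) := fun γ =>
    hψm.comp (moeb_measurable _ _)
  have hinvact : ∀ γ : Γ, ∀ w ∈ unitDisc, ρ γ (ρ γ⁻¹ w) = w := by
    intro γ w hw
    rw [← hΓ.mul_act γ γ⁻¹ w hw, mul_inv_cancel, hΓ.one_act w hw]
  -- expand the left-hand side
  have h1 : ∀ z, ψ z * ∫⁻ w, k z w ∂hyp
      = ∑' γ : Γ, ∫⁻ w, ψ z * (k z w * ψ (ρ γ w)) ∂hyp := by
    intro z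
    rw [← lintegral_const_mul _ (hkz z)]
    have : ∀ γ : Γ, ∫⁻ w, ψ z * (k z w * ψ (ρ γ w)) ∂hyp
        = ∫⁻ w, ψ z * (k z w * ψ (moeb (α γ) (β γ) w)) ∂hyp := fun γ =>
      hyp_congr fun w hw => by rw [hm' γ w hw]
    simp only [this]
    have hmeas : ∀ γ : Γ, Measurable fun w => ψ z * (k z w * ψ (moeb (α γ) (β γ) w)) := fun γ =>
      ((hkz z).mul (hψγ γ)).const_mul _
    rw [← lintegral_tsum fun γ => (hmeas γ).aemeasurable]
    apply hyp_congr
    intro w hw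
    rw [ENNReal.tsum_mul_left, ENNReal.tsum_mul_left]
    simp only [← hm' _ w hw, hψ w hw, mul_one]
  have h2 : ∀ γ : Γ, ∫⁻ z, ∫⁻ w, ψ z * (k z w * ψ (ρ γ w)) ∂hyp ∂hyp
      = ∫⁻ z, ∫⁻ w, ψ (ρ γ⁻¹ z) * (k z w * ψ w) ∂hyp ∂hyp := by
    intro γ
    rw [← hyp_act hΓ γ⁻¹]
    apply hyp_congr
    intro z hz
    rw [← hyp_act hΓ γ⁻¹]
    apply hyp_congr
    intro w hw
    rw [hinvact γ w hw, hinv _ z hz w hw]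
  have hjm : ∀ γ : Γ, Measurable fun q : ℂ × ℂ => ψ q.1 * (k q.1 q.2 * ψ (moeb (α γ) (β γ) q.2)) :=
    fun γ => (hψm.comp measurable_fst).mul (hk.mul ((hψγ γ).comp measurable_snd))
  have hjm' : ∀ γ : Γ, Measurable fun q : ℂ × ℂ => ψ (moeb (α γ) (β γ) q.1) * (k q.1 q.2 * ψ q.2) :=
    fun γ => ((hψγ γ).comp measurable_fst).mul (hk.mul (hψm.comp measurable_snd))
  calc ∫⁻ z, ψ z * ∫⁻ w, k z w ∂hyp ∂hyp
      = ∫⁻ z, ∑' γ : Γ, ∫⁻ w, ψ z * (k z w * ψ (moeb (α γ) (β γ) w)) ∂hyp ∂hyp := by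
        simp only [h1]
        congr 1
        ext z
        exact tsum_congr fun γ => hyp_congr fun w hw => by rw [hm' γ w hw]
    _ = ∑' γ : Γ, ∫⁻ z, ∫⁻ w, ψ z * (k z w * ψ (moeb (α γ) (β γ) w)) ∂hyp ∂hyp :=
        lintegral_tsum fun γ => (hjm γ).lintegral_prod_right'.aemeasurable
    _ = ∑' γ : Γ, ∫⁻ z, ∫⁻ w, ψ z * (k z w * ψ (ρ γ w)) ∂hyp ∂hyp :=
        tsum_congr fun γ => hyp_congr fun z _ => hyp_congr fun w hw => by rw [hm' γ w hw]
    _ = ∑' γ : Γ, ∫⁻ z, ∫⁻ w, ψ (ρ γ⁻¹ z) * (k z w * ψ w) ∂hyp ∂hyp := tsum_congr h2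
    _ = ∑' γ : Γ, ∫⁻ z, ∫⁻ w, ψ (ρ γ z) * (k z w * ψ w) ∂hyp ∂hyp :=
        (Equiv.inv Γ).tsum_eq fun γ => ∫⁻ z, ∫⁻ w, ψ (ρ γ z) * (k z w * ψ w) ∂hyp ∂hyp
    _ = ∑' γ : Γ, ∫⁻ z, ∫⁻ w, ψ (moeb (α γ) (β γ) z) * (k z w * ψ w) ∂hyp ∂hyp :=
        tsum_congr fun γ => hyp_congr fun z hz => by rw [hm' γ z hz]
    _ = ∑' γ : Γ, ∫⁻ w, ∫⁻ z, ψ (moeb (α γ) (β γ) z) * (k z w * ψ w) ∂hyp ∂hyp :=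
        tsum_congr fun γ => lintegral_lintegral_swap (hjm' γ).aemeasurable
    _ = ∫⁻ w, ∑' γ : Γ, ∫⁻ z, ψ (moeb (α γ) (β γ) z) * (k z w * ψ w) ∂hyp ∂hyp :=
        (lintegral_tsum fun γ => (hjm' γ).lintegral_prod_left'.aemeasurable).symm
    _ = ∫⁻ w, ψ w * ∫⁻ z, k z w ∂hyp ∂hyp := by
        congr 1
        ext w
        have hmeas : ∀ γ : Γ, Measurable fun z => ψ (moeb (α γ) (β γ) z) * (k z w * ψ w) :=
          fun γ => (hψγ γ).mul ((hkw w).mul_const _)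
        rw [← lintegral_tsum fun γ => (hmeas γ).aemeasurable,
          ← lintegral_const_mul _ (hkw w)]
        apply hyp_congr
        intro z hz
        rw [ENNReal.tsum_mul_right]
        simp only [← hm' _ z hz, hψ z hz, one_mul]
        rw [mul_comm]

open MeasureTheory in
theorem weight_ne_zero {Γ : Type*} [Group Γ] {ρ : Γ → ℂ → ℂ} (hΓ : IsCocompactFuchsian Γ ρ)
    {ψ : ℂ → ENNReal} (hψm : Measurable ψ) (hψ : ∀ z ∈ unitDisc, ∑' γ : Γ, ψ (ρ γ z) = 1) :
    ∫⁻ z, ψ z ∂hyp ≠ 0 := by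
  have := countable_of_fuchsian hΓ
  choose α β hαβ hm using hΓ.moebius
  intro h0
  have h1 : ∫⁻ _z, 1 ∂hyp = ∑' γ : Γ, ∫⁻ z, ψ (moeb (α γ) (β γ) z) ∂hyp := by
    have hmeas : ∀ γ : Γ, Measurable fun z => ψ (moeb (α γ) (β γ) z) :=
      fun γ => hψm.comp (moeb_measurable _ _)
    rw [← lintegral_tsum fun γ => (hmeas γ).aemeasurable]
    apply hyp_congr
    intro z hz
    rw [← hψ z hz]
    exact tsum_congr fun γ => by rw [hm γ z hz]; rfl
  simp only [hyp_moeb (hαβ _), h0, tsum_zero, lintegral_one] at h1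
  have h2 := restrict_ac_hyp h1
  rw [Measure.restrict_apply_univ] at h2
  exact (Metric.measure_ball_pos volume (0:ℂ) one_pos).ne' h2

/-! ### An inequality for pairs of mutually inverse monotone functions -/

/-- Lebesgue measure on the open unit interval. -/
def lam : MeasureTheory.Measure ℝ := MeasureTheory.volume.restrict (Ioo 0 1)

instance : MeasureTheory.SFinite lam := by unfold lam; infer_instance

open MeasureTheory in
theorem ae_lam_mem : ∀ᵐ t ∂lam, t ∈ Ioo (0:ℝ) 1 := ae_restrict_mem measurableSet_Ioo

open MeasureTheory in
theorem slice_lt {y : ℝ} (hy0 : 0 ≤ y) (hy1 : y ≤ 1) :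
    ∫⁻ s, (if s < y then 1 else 0 : ENNReal) ∂lam = ENNReal.ofReal y := by
  have h : (fun s : ℝ => (if s < y then 1 else 0 : ENNReal)) = (Iio y).indicator 1 := by
    ext s; simp [indicator_apply]
  rw [h, lintegral_indicator_one measurableSet_Iio, lam, Measure.restrict_apply measurableSet_Iio]
  have : Iio y ∩ Ioo 0 1 = Ioo 0 y := by
    ext s; simp only [mem_inter_iff, mem_Iio, mem_Ioo]
    constructor
    · rintro ⟨h1, h2, h3⟩; exact ⟨h2, h1⟩
    · rintro ⟨h1, h2⟩; exact ⟨h2, h1, by linarith⟩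
  rw [this, Real.volume_Ioo, sub_zero]

open MeasureTheory in
theorem slice_le {y : ℝ} (hy0 : 0 ≤ y) (hy1 : y < 1) :
    ∫⁻ s, (if s ≤ y then 1 else 0 : ENNReal) ∂lam = ENNReal.ofReal y := by
  have h : (fun s : ℝ => (if s ≤ y then 1 else 0 : ENNReal)) = (Iic y).indicator 1 := by
    ext s; simp [indicator_apply]
  rw [h, lintegral_indicator_one measurableSet_Iic, lam, Measure.restrict_apply measurableSet_Iic]
  have : Iic y ∩ Ioo 0 1 = Ioc 0 y := by
    ext s; simp only [mem_inter_iff, mem_Iic, mem_Ioo, mem_Ioc]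
    constructor
    · rintro ⟨h1, h2, h3⟩; exact ⟨h2, h1⟩
    · rintro ⟨h1, h2⟩; exact ⟨h2, h1, by linarith⟩
  rw [this, Real.volume_Ioc, sub_zero]

/-- The integrand on the square. -/
def sqQ (f : ℝ → ℝ) (t s : ℝ) : ENNReal := ENNReal.ofReal t * (if s < f t then 1 else 0)

theorem sqQ_measurable {f : ℝ → ℝ} (hf : Measurable f) :
    Measurable fun q : ℝ × ℝ => sqQ f q.1 q.2 := by
  unfold sqQ
  refine Measurable.mul (by fun_prop) ?_
  exact Measurable.ite (measurableSet_lt measurable_snd (hf.comp measurable_fst))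
    measurable_const measurable_const

/-- Closed variant of the integrand for the identity. -/
def sqE (t s : ℝ) : ENNReal := ENNReal.ofReal t * (if s ≤ t then 1 else 0)

theorem sqE_measurable : Measurable fun q : ℝ × ℝ => sqE q.1 q.2 := by
  unfold sqE
  refine Measurable.mul (by fun_prop) ?_
  exact Measurable.ite (measurableSet_le measurable_snd measurable_fst)
    measurable_const measurable_const

open MeasureTheory in
theorem sqQ_integral {f : ℝ → ℝ} (hf : Measurable f)
    (hf01 : ∀ t ∈ Ioo (0:ℝ) 1, f t ∈ Icc (0:ℝ) 1) :
    ∫⁻ q, sqQ f q.1 q.2 ∂(lam.prod lam) = ∫⁻ t, ENNReal.ofReal t * ENNReal.ofReal (f t) ∂lam := by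
  rw [lintegral_prod _ (sqQ_measurable hf).aemeasurable]
  apply lintegral_congr_ae
  filter_upwards [ae_lam_mem] with t ht
  have hm : Measurable fun s : ℝ => (if s < f t then 1 else 0 : ENNReal) :=
    Measurable.ite measurableSet_Iio measurable_const measurable_const
  simp only [sqQ]
  rw [lintegral_const_mul _ hm, slice_lt (hf01 t ht).1 (hf01 t ht).2]

open MeasureTheory in
theorem sqE_integral :
    ∫⁻ q, sqE q.1 q.2 ∂(lam.prod lam) = ∫⁻ t, ENNReal.ofReal t * ENNReal.ofReal t ∂lam := by
  rw [lintegral_prod _ sqE_measurable.aemeasurable]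
  apply lintegral_congr_ae
  filter_upwards [ae_lam_mem] with t ht
  have hm : Measurable fun s : ℝ => (if s ≤ t then 1 else 0 : ENNReal) :=
    Measurable.ite measurableSet_Iic measurable_const measurable_const
  simp only [sqE]
  rw [lintegral_const_mul _ hm, slice_le ht.1.le ht.2]

/-- The integral of `t²`. -/
def c2 : ENNReal := ∫⁻ t, ENNReal.ofReal t * ENNReal.ofReal t ∂lam

open MeasureTheory in
theorem c2_ne_top : c2 ≠ ⊤ := by
  apply ne_of_lt
  calc c2 ≤ ∫⁻ _t, 1 ∂lam := by
        apply lintegral_mono_ae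
        filter_upwards [ae_lam_mem] with t ht
        have : ENNReal.ofReal t ≤ 1 := ENNReal.ofReal_le_one.2 ht.2.le
        exact mul_le_one' this this
    _ < ⊤ := by simp [lam]

open MeasureTheory in
theorem sq_le_and_eq {f g : ℝ → ℝ} (hf : Measurable f) (hg : Measurable g)
    (hf01 : ∀ t ∈ Ioo (0:ℝ) 1, f t ∈ Icc (0:ℝ) 1)
    (hg01 : ∀ t ∈ Ioo (0:ℝ) 1, g t ∈ Icc (0:ℝ) 1)
    (hex : ∀ s ∈ Ioo (0:ℝ) 1, ∀ t ∈ Ioo (0:ℝ) 1, ¬ (s < f t ∧ t < g s)) :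
    (∫⁻ t, ENNReal.ofReal t * ENNReal.ofReal (f t) ∂lam) +
      (∫⁻ t, ENNReal.ofReal t * ENNReal.ofReal (g t) ∂lam) ≤ c2 + c2 ∧
    ((∫⁻ t, ENNReal.ofReal t * ENNReal.ofReal (f t) ∂lam) +
      (∫⁻ t, ENNReal.ofReal t * ENNReal.ofReal (g t) ∂lam) = c2 + c2 →
      MonotoneOn f (Ioo 0 1) → ∀ t ∈ Ioo (0:ℝ) 1, t ≤ f t) := by
  have hid : ∀ t ∈ Ioo (0:ℝ) 1, id t ∈ Icc (0:ℝ) 1 := fun t ht => ⟨ht.1.le, ht.2.le⟩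
  have hgs : ∫⁻ q, sqQ g q.2 q.1 ∂(lam.prod lam)
      = ∫⁻ t, ENNReal.ofReal t * ENNReal.ofReal (g t) ∂lam := by
    rw [← sqQ_integral hg hg01, ← lintegral_prod_swap]
    rfl
  have hes : ∫⁻ q, sqE q.2 q.1 ∂(lam.prod lam) = c2 := by
    rw [c2, ← sqE_integral, ← lintegral_prod_swap]
    rfl
  have hl : (∫⁻ t, ENNReal.ofReal t * ENNReal.ofReal (f t) ∂lam) +
      (∫⁻ t, ENNReal.ofReal t * ENNReal.ofReal (g t) ∂lam)
      = ∫⁻ q, (sqQ f q.1 q.2 + sqQ g q.2 q.1) ∂(lam.prod lam) := by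
    rw [lintegral_add_left (sqQ_measurable hf), sqQ_integral hf hf01, hgs]
  have hr : c2 + c2 = ∫⁻ q, (sqQ id q.1 q.2 + sqE q.2 q.1) ∂(lam.prod lam) := by
    rw [lintegral_add_left (sqQ_measurable measurable_id), sqQ_integral measurable_id hid, hes]
    rfl
  have hmem : ∀ᵐ q ∂(lam.prod lam), q ∈ Ioo (0:ℝ) 1 ×ˢ Ioo (0:ℝ) 1 := by
    rw [lam, Measure.prod_restrict]
    exact ae_restrict_mem (measurableSet_Ioo.prod measurableSet_Ioo)
  have hle : (fun q : ℝ × ℝ => sqQ f q.1 q.2 + sqQ g q.2 q.1) ≤ᵐ[lam.prod lam]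
      fun q => sqQ id q.1 q.2 + sqE q.2 q.1 := by
    filter_upwards [hmem] with q hq
    obtain ⟨t, s⟩ := q
    obtain ⟨ht, hs⟩ := hq
    have := hex s hs t ht
    simp only [sqQ, sqE, id]
    by_cases h1 : s < f t <;> by_cases h2 : t < g s <;> by_cases h3 : s < t
    · exact absurd ⟨h1, h2⟩ this
    · exact absurd ⟨h1, h2⟩ this
    · simp [h1, h2, h3]
    · simp only [h1, h2, h3, not_lt.1 h3, if_true, if_false, mul_one, mul_zero, add_zero, zero_add]
      exact ENNReal.ofReal_le_ofReal (not_lt.1 h3)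
    · simp only [h1, h2, h3, not_le.2 h3, if_true, if_false, mul_one, mul_zero, add_zero, zero_add]
      exact ENNReal.ofReal_le_ofReal h3.le
    · simp [h1, h2, h3, not_lt.1 h3]
    · simp [h1, h2]
    · simp [h1, h2]
  refine ⟨?_, ?_⟩
  · rw [hl, hr]; exact lintegral_mono_ae hle
  · intro heq hmono t₀ ht₀
    by_contra hlt
    push Not at hlt
    have htop : ∫⁻ q, (sqQ f q.1 q.2 + sqQ g q.2 q.1) ∂(lam.prod lam) ≠ ⊤ := by
      rw [← hl, heq]
      exact ENNReal.add_ne_top.2 ⟨c2_ne_top, c2_ne_top⟩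
    have hae := ae_eq_of_ae_le_of_lintegral_le hle htop
      ((sqQ_measurable measurable_id).add (sqE_measurable.comp measurable_swap)).aemeasurable
      (by rw [← hl, ← hr, heq])
    set U : Set (ℝ × ℝ) := {q | f t₀ < q.2 ∧ q.2 < q.1 ∧ q.1 < t₀} with hU
    have hUo : IsOpen U := by
      apply IsOpen.inter (isOpen_lt continuous_const continuous_snd)
      exact IsOpen.inter (isOpen_lt continuous_snd continuous_fst)
        (isOpen_lt continuous_fst continuous_const)
    have hUne : U.Nonempty :=
      ⟨((f t₀ + 2 * t₀) / 3, (2 * f t₀ + t₀) / 3), by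
        refine ⟨?_, ?_, ?_⟩ <;> simp only <;> linarith⟩
    have hf0 := (hf01 t₀ ht₀).1
    have hUsub : U ⊆ Ioo (0:ℝ) 1 ×ˢ Ioo (0:ℝ) 1 := by
      rintro ⟨t, s⟩ ⟨h1, h2, h3⟩
      simp only at h1 h2 h3
      have := ht₀.2
      exact ⟨⟨by linarith, by linarith⟩, ⟨by linarith, by linarith⟩⟩
    have hpos : 0 < (lam.prod lam) U := by
      rw [lam, Measure.prod_restrict, Measure.restrict_apply hUo.measurableSet,
        inter_eq_left.2 hUsub]
      exact hUo.measure_pos _ hUne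
    have hno : ∀ᵐ q ∂(lam.prod lam), q ∉ U := by
      filter_upwards [hae] with q hq hqU
      have hqm := hUsub hqU
      obtain ⟨t, s⟩ := q
      obtain ⟨h1, h2, h3⟩ := hqU
      simp only at h1 h2 h3
      have hft : f t ≤ f t₀ := hmono hqm.1 ht₀ h3.le
      have h4 : ¬ s < f t := not_lt.2 (hft.trans h1.le)
      simp only [sqQ, sqE, id, h4, h2, not_le.2 h2, if_true, if_false, mul_one, mul_zero, add_zero,
        zero_add] at hq
      have h5 : ENNReal.ofReal s < ENNReal.ofReal t :=
        (ENNReal.ofReal_lt_ofReal_iff hqm.1.1).2 h2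
      by_cases h6 : t < g s
      · simp only [h6, if_true, mul_one] at hq
        exact absurd hq h5.ne
      · simp only [h6, if_false, mul_zero] at hq
        rw [← hq] at h5
        exact absurd h5 (by simp)
    rw [ae_iff] at hno
    simp only [not_not, setOf_mem_eq] at hno
    exact hpos.ne' hno


/-! ### The core argument: monotone families -/

/-- A continuous family of harmonic functions, parametrised by the interval, that is invariant under
a group acting on the disc and on the parameter interval. -/
structure Fam (Γ : Type*) [Group Γ] (ρ : Γ → ℂ → ℂ) (σ : Γ → unitInterval → unitInterval)
    (f : unitInterval → ℂ → ℝ) : Prop where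
  fuchs : IsCocompactFuchsian Γ ρ
  cont : ContinuousOn (fun q : unitInterval × ℂ => f q.1 q.2) (univ ×ˢ unitDisc)
  meas : Measurable (fun q : unitInterval × ℂ => f q.1 q.2)
  harm : ∀ x, Harm (f x)
  inv : ∀ l x, ∀ z ∈ unitDisc, f (σ l x) (ρ l z) = f x z

/-- The hypotheses of the core argument. -/
structure Core (Γ : Type*) [Group Γ] (ρ : Γ → ℂ → ℂ) (σ : Γ → unitInterval → unitInterval)
    (f : unitInterval → ℂ → ℝ) (a b : unitInterval) : Prop extends Fam Γ ρ σ f where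
  mono : ∀ l, StrictMono (σ l)
  hab : a < b
  fa : ∀ l, σ l a = a
  fb : ∀ l, σ l b = b
  h0 : ∀ z ∈ unitDisc, f a z = 0
  h1 : ∀ z ∈ unitDisc, f b z = 1
  nc : ∀ x, a < x → x < b → ¬ ∃ c, ∀ z ∈ unitDisc, f x z = c

theorem Fam.cont_left {Γ : Type*} [Group Γ] {ρ : Γ → ℂ → ℂ} {σ : Γ → unitInterval → unitInterval}
    {f : unitInterval → ℂ → ℝ} (h : Fam Γ ρ σ f) {z : ℂ} (hz : z ∈ unitDisc) :
    Continuous fun x => f x z := by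
  have h1 : Continuous fun x : unitInterval => (x, z) := by fun_prop
  have := h.cont.comp h1.continuousOn (s := univ) (fun x _ => ⟨mem_univ _, hz⟩)
  exact continuousOn_univ.1 this

theorem Core.monotone_eps {Γ : Type*} [Group Γ] {ρ : Γ → ℂ → ℂ}
    {σ : Γ → unitInterval → unitInterval}
    {f : unitInterval → ℂ → ℝ} {a b : unitInterval} (h : Core Γ ρ σ f a b)
    {e : ℝ} (he : 0 < e) {x y : unitInterval} (hax : a ≤ x) (hxy : x ≤ y) (hyb : y ≤ b) {z : ℂ}
    (hz : z ∈ unitDisc) : f x z - f y z + e * ((f x z) ^ 2 + (f y z) ^ 2) ≤ 2 * e := by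
  obtain ⟨K, hKD, hK, hcov⟩ := h.fuchs.cocompact
  obtain ⟨P, hP⟩ : ∃ P : (unitInterval × unitInterval) × ℂ → ℝ, P = fun q =>
    f q.1.1 q.2 - f q.1.2 q.2 + e * ((f q.1.1 q.2) ^ 2 + (f q.1.2 q.2) ^ 2) := ⟨_, rfl⟩
  obtain ⟨T, hT⟩ : ∃ T : Set (unitInterval × unitInterval),
    T = {p | a ≤ p.1 ∧ p.1 ≤ p.2 ∧ p.2 ≤ b} := ⟨_, rfl⟩
  have hTc : IsClosed T := by
    rw [hT]
    exact (isClosed_le (by fun_prop) (by fun_prop)).inter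
      ((isClosed_le (by fun_prop) (by fun_prop)).inter (isClosed_le (by fun_prop) (by fun_prop)))
  have hTK : IsCompact (T ×ˢ K) := hTc.isCompact.prod hK
  have hPc : ContinuousOn P (T ×ˢ K) := by
    have c1 : ContinuousOn (fun q : (unitInterval × unitInterval) × ℂ => f q.1.1 q.2) (T ×ˢ K) :=
      h.cont.comp (f := fun q : (unitInterval × unitInterval) × ℂ => (q.1.1, q.2))
        (Continuous.continuousOn (by fun_prop)) (fun q hq => ⟨mem_univ _, hKD hq.2⟩)
    have c2 : ContinuousOn (fun q : (unitInterval × unitInterval) × ℂ => f q.1.2 q.2) (T ×ˢ K) :=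
      h.cont.comp (f := fun q : (unitInterval × unitInterval) × ℂ => (q.1.2, q.2))
        (Continuous.continuousOn (by fun_prop)) (fun q hq => ⟨mem_univ _, hKD hq.2⟩)
    rw [hP]
    exact (c1.sub c2).add (continuousOn_const.mul ((c1.pow 2).add (c2.pow 2)))
  obtain ⟨γ, hγ⟩ := hcov z hz
  have hmem : ((x, y), z) = ((x, y), z) := rfl
  obtain ⟨⟨⟨x0, y0⟩, z0⟩, ⟨hT0, hz0⟩, hmax⟩ :=
    hTK.exists_isMaxOn ⟨((a, a), ρ γ z), by rw [hT]; exact ⟨le_rfl, le_rfl, h.hab.le⟩, hγ⟩ hPc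
  have key : ∀ x y, a ≤ x → x ≤ y → y ≤ b → ∀ z ∈ unitDisc, P ((x, y), z) ≤ P ((x0, y0), z0) := by
    intro x y hax hxy hyb z hz
    obtain ⟨γ, hγ⟩ := hcov z hz
    have := hmax (a := ((σ γ x, σ γ y), ρ γ z)) ⟨by
      rw [hT]
      exact ⟨by simpa [h.fa] using (h.mono γ).monotone hax, (h.mono γ).monotone hxy,
        by simpa [h.fb] using (h.mono γ).monotone hyb⟩, hγ⟩
    simp only [mem_setOf_eq] at this
    refine le_trans (le_of_eq ?_) this
    simp only [hP, h.inv γ _ z hz]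
  refine le_trans (le_trans (le_of_eq (by rw [hP])) (key x y hax hxy hyb z hz)) ?_
  rw [hT] at hT0
  obtain ⟨hx0, hxy0, hy0⟩ := hT0
  simp only at hx0 hxy0 hy0 hz0
  have hz0D := hKD hz0
  -- the affine combination
  obtain ⟨A, hA⟩ : ∃ A, A = f x0 z0 := ⟨_, rfl⟩
  obtain ⟨B, hB⟩ : ∃ B, B = f y0 z0 := ⟨_, rfl⟩
  obtain ⟨v, hv⟩ : ∃ v : ℂ → ℝ, v = fun z => (-1 - 2 * e * A) * f x0 z + ((1 - 2 * e * B) * f y0 z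
    + (A - B + e * (A ^ 2 + B ^ 2) + e * A ^ 2 + e * B ^ 2)) := ⟨_, rfl⟩
  have hvH : Harm v := by
    rw [hv]
    exact ((h.harm x0).smul _).add (((h.harm y0).smul _).add (Harm.const _))
  have hv0 : v z0 = 0 := by rw [hv]; simp only [← hA, ← hB]; ring
  have hvq : ∀ z ∈ unitDisc, e * ((f x0 z - A) ^ 2 + (f y0 z - B) ^ 2) ≤ v z := by
    intro z hz
    have := key x0 y0 hx0 hxy0 hy0 z hz
    rw [hP] at this
    simp only [← hA, ← hB] at this
    rw [hv]; simp only
    nlinarith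
  have hvc := hvH.const_of_isLocalMin hz0D (by
    filter_upwards [isOpen_unitDisc.mem_nhds hz0D] with z hz
    rw [hv0]
    exact le_trans (by positivity) (hvq z hz))
  have hc : ∀ z ∈ unitDisc, f x0 z = A ∧ f y0 z = B := by
    intro z hz
    have h1 := hvq z hz
    rw [hvc z hz, hv0] at h1
    have h2 : (f x0 z - A) ^ 2 + (f y0 z - B) ^ 2 ≤ 0 := by
      by_contra hcon
      push Not at hcon
      have := mul_pos he hcon
      linarith
    constructor
    · nlinarith [sq_nonneg (f x0 z - A), sq_nonneg (f y0 z - B)]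
    · nlinarith [sq_nonneg (f x0 z - A), sq_nonneg (f y0 z - B)]
  have hval : ∀ x, a ≤ x → x ≤ b → (∃ c, ∀ z ∈ unitDisc, f x z = c) → x = a ∨ x = b := by
    intro x h1 h2 h3
    by_contra hcon
    push Not at hcon
    exact h.nc x (lt_of_le_of_ne h1 (Ne.symm hcon.1)) (lt_of_le_of_ne h2 hcon.2) h3
  have hxv := hval x0 hx0 (hxy0.trans hy0) ⟨A, fun z hz => (hc z hz).1⟩
  have hyv := hval y0 (hx0.trans hxy0) hy0 ⟨B, fun z hz => (hc z hz).2⟩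
  rw [hP]
  simp only
  have ea := h.h0 z0 hz0D
  have eb := h.h1 z0 hz0D
  rcases hxv with rfl | rfl
  · rcases hyv with rfl | rfl
    · rw [ea]; nlinarith
    · rw [ea, eb]; nlinarith
  · have : y0 = x0 := le_antisymm hy0 hxy0
    subst this
    rw [eb]; nlinarith

section
variable {Γ : Type*} [Group Γ] {ρ : Γ → ℂ → ℂ} {σ : Γ → unitInterval → unitInterval}
    {f : unitInterval → ℂ → ℝ} {a b : unitInterval}

theorem Core.monotone (h : Core Γ ρ σ f a b) {x y : unitInterval} (hax : a ≤ x) (hxy : x ≤ y)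
    (hyb : y ≤ b) {z : ℂ} (hz : z ∈ unitDisc) : f x z ≤ f y z := by
  by_contra hcon
  push Not at hcon
  have he : 0 < (f x z - f y z) / 4 := by linarith
  have := h.monotone_eps he hax hxy hyb hz
  nlinarith [mul_nonneg he.le (add_nonneg (sq_nonneg (f x z)) (sq_nonneg (f y z)))]

theorem Core.touch' (h : Core Γ ρ σ f a b) {x y : unitInterval} (hax : a ≤ x) (hxy : x ≤ y)
    (hyb : y ≤ b) {z w : ℂ} (hz : z ∈ unitDisc) (hw : w ∈ unitDisc) (he : f x z = f y z) :
    f x w = f y w := by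
  have hH : Harm (fun z => f y z + (-1) * f x z) := (h.harm y).add ((h.harm x).smul _)
  have := hH.const_of_isLocalMin hz (by
    filter_upwards [isOpen_unitDisc.mem_nhds hz] with u hu
    have := h.monotone hax hxy hyb hu
    linarith) w hw
  linarith

theorem Core.touch (h : Core Γ ρ σ f a b) {x y : unitInterval} (hax : a ≤ x) (hxb : x ≤ b)
    (hay : a ≤ y) (hyb : y ≤ b) {z w : ℂ} (hz : z ∈ unitDisc) (hw : w ∈ unitDisc)
    (he : f x z = f y z) : f x w = f y w := by
  rcases le_total x y with hxy | hxy
  · exact h.touch' hax hxy hyb hz hw he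
  · exact (h.touch' hay hxy hxb hz hw he.symm).symm

theorem Core.nonneg (h : Core Γ ρ σ f a b) {x : unitInterval} (hax : a ≤ x) (hxb : x ≤ b) {z : ℂ}
    (hz : z ∈ unitDisc) : 0 ≤ f x z := by
  rw [← h.h0 z hz]; exact h.monotone le_rfl hax hxb hz

theorem Core.le_one (h : Core Γ ρ σ f a b) {x : unitInterval} (hax : a ≤ x) (hxb : x ≤ b) {z : ℂ}
    (hz : z ∈ unitDisc) : f x z ≤ 1 := by
  rw [← h.h1 z hz]; exact h.monotone hax hxb le_rfl hz

/-- The level function. -/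
theorem Core.exists_xs (h : Core Γ ρ σ f a b) : ∃ xs : ℂ → ℝ → unitInterval,
    (Measurable fun q : ℂ × ℝ => xs q.1 q.2) ∧ (∀ z t, a ≤ xs z t ∧ xs z t ≤ b) ∧
    (∀ z, Monotone (xs z)) ∧
    ∀ z ∈ unitDisc, ∀ t, 0 ≤ t → t ≤ 1 → f (xs z t) z = t := by
  obtain ⟨S, hS⟩ : ∃ S : ℂ → ℝ → Set unitInterval, S = fun z t =>
    {a} ∪ {x | x ∈ Icc a b ∧ z ∈ unitDisc ∧ f x z ≤ t} := ⟨_, rfl⟩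
  have hSc : ∀ z t, IsCompact (S z t) := by
    intro z t
    rw [hS]
    apply IsClosed.isCompact
    apply isClosed_singleton.union
    by_cases hz : z ∈ unitDisc
    · have : {x | x ∈ Icc a b ∧ z ∈ unitDisc ∧ f x z ≤ t} = Icc a b ∩ {x | f x z ≤ t} := by
        ext x; simp [hz]
      rw [this]
      exact isClosed_Icc.inter (isClosed_le (h.cont_left hz) continuous_const)
    · simp [hz]
  have hex : ∀ z t, ∃ x, IsGreatest (S z t) x := fun z t =>
    (hSc z t).exists_isGreatest ⟨a, by rw [hS]; exact Or.inl rfl⟩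
  choose xs hxs using hex
  have hab : ∀ z t, a ≤ xs z t ∧ xs z t ≤ b := by
    intro z t
    have := (hxs z t).1
    rw [hS] at this
    rcases this with h1 | h1
    · rw [mem_singleton_iff] at h1; rw [h1]; exact ⟨le_rfl, h.hab.le⟩
    · exact h1.1
  have hle : ∀ z t c, a < c → c ≤ b → (c ≤ xs z t ↔ z ∈ unitDisc ∧ f c z ≤ t) := by
    intro z t c hac hcb
    constructor
    · intro hc
      have := (hxs z t).1
      rw [hS] at this
      rcases this with h1 | h1
      · rw [mem_singleton_iff] at h1; rw [h1] at hc; exact absurd hac (not_lt.2 hc)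
      · exact ⟨h1.2.1, (h.monotone hac.le hc h1.1.2 h1.2.1).trans h1.2.2⟩
    · rintro ⟨hz, hc⟩
      apply (hxs z t).2
      rw [hS]
      exact Or.inr ⟨⟨hac.le, hcb⟩, hz, hc⟩
  refine ⟨xs, ?_, hab, ?_, ?_⟩
  · apply measurable_of_Ici
    intro c
    by_cases h1 : c ≤ a
    · convert MeasurableSet.univ
      ext q; simpa using h1.trans (hab q.1 q.2).1
    push Not at h1
    by_cases h2 : c ≤ b
    · have : (fun q : ℂ × ℝ => xs q.1 q.2) ⁻¹' Ici c =
          {q | q.1 ∈ unitDisc} ∩ {q | f c q.1 ≤ q.2} := by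
        ext q; exact hle q.1 q.2 c h1 h2
      rw [this]
      apply MeasurableSet.inter
      · exact measurable_fst isOpen_unitDisc.measurableSet
      · apply measurableSet_le _ measurable_snd
        exact h.meas.comp (g := fun q : unitInterval × ℂ => f q.1 q.2)
          (f := fun q : ℂ × ℝ => (c, q.1)) (by fun_prop)
    · convert MeasurableSet.empty
      ext q
      simp only [mem_preimage, mem_Ici, mem_empty_iff_false, iff_false]
      intro h3; exact h2 (h3.trans (hab q.1 q.2).2)
  · intro z s t hst
    apply (hxs z t).2
    have := (hxs z s).1
    rw [hS] at this ⊢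
    rcases this with h1 | h1
    · exact Or.inl h1
    · exact Or.inr ⟨h1.1, h1.2.1, h1.2.2.trans hst⟩
  · intro z hz t ht0 ht1
    have hle' : f (xs z t) z ≤ t := by
      have := (hxs z t).1
      rw [hS] at this
      rcases this with h1 | h1
      · rw [mem_singleton_iff] at h1; rw [h1, h.h0 z hz]; exact ht0
      · exact h1.2.2
    by_contra hne
    have hlt := lt_of_le_of_ne hle' hne
    have hpre : IsPreconnected (Icc (xs z t) b) := isPreconnected_Icc
    obtain ⟨x, hx, hxt⟩ := hpre.intermediate_value (left_mem_Icc.2 (hab z t).2)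
      (right_mem_Icc.2 (hab z t).2) (f := fun x => f x z) (h.cont_left hz).continuousOn
      (show t ∈ Icc _ _ from ⟨hlt.le, by simp only [h.h1 z hz]; exact ht1⟩)
    have hx2 : x ≤ xs z t := by
      apply (hxs z t).2
      rw [hS]
      exact Or.inr ⟨⟨(hab z t).1.trans hx.1, hx.2⟩, hz, le_of_eq hxt⟩
    have : x = xs z t := le_antisymm hx2 hx.1
    rw [this] at hxt
    exact hne hxt
end

section
variable {Γ : Type*} [Group Γ] {ρ : Γ → ℂ → ℂ} {σ : Γ → unitInterval → unitInterval}
    {f : unitInterval → ℂ → ℝ} {a b : unitInterval}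

theorem pdist_continuousOn {z : ℂ} (hz : z ∈ unitDisc) :
    ContinuousOn (fun w => pdist z w) unitDisc := by
  unfold pdist
  apply ContinuousOn.div (by fun_prop) (by fun_prop)
  intro w hw
  have h1 := mem_unitDisc.1 hz
  have h2 := mem_unitDisc.1 hw
  have h3 : 0 < 1 - ‖z‖ ^ 2 := by nlinarith [norm_nonneg z]
  have h4 : 0 < 1 - ‖w‖ ^ 2 := by nlinarith [norm_nonneg w]
  positivity

open MeasureTheory in
theorem pk_mass {z : ℂ} (hz : z ∈ unitDisc) : ∫⁻ w, pk z w ∂hyp = massC := by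
  have := mean_value (Harm.const 1) measurable_const (fun _ _ => zero_le_one) hz
  simpa using this

open MeasureTheory in
theorem Core.false (h : Core Γ ρ σ f a b) : False := by
  obtain ⟨xs, hxm, hxab, hxmono, hxv⟩ := h.exists_xs
  obtain ⟨ψ, hψm, hψt, hψ⟩ := exists_weight h.fuchs
  obtain ⟨B, hB⟩ : ∃ B : ℂ → ℂ → ENNReal, B = fun z w =>
    ∫⁻ t, ENNReal.ofReal t * ENNReal.ofReal (f (xs z t) w) ∂lam := ⟨_, rfl⟩
  have hG : Measurable fun q : (ℂ × ℂ) × ℝ =>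
      ENNReal.ofReal q.2 * ENNReal.ofReal (f (xs q.1.1 q.2) q.1.2) := by
    have h1 : Measurable fun q : (ℂ × ℂ) × ℝ => xs q.1.1 q.2 :=
      hxm.comp (f := fun q : (ℂ × ℂ) × ℝ => (q.1.1, q.2)) (by fun_prop)
    have h2 : Measurable fun q : (ℂ × ℂ) × ℝ => f (xs q.1.1 q.2) q.1.2 :=
      h.meas.comp (f := fun q : (ℂ × ℂ) × ℝ => (xs q.1.1 q.2, q.1.2)) (by fun_prop)
    exact (measurable_snd.ennreal_ofReal).mul h2.ennreal_ofReal
  have hBm : Measurable fun q : ℂ × ℂ => B q.1 q.2 := by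
    rw [hB]; exact hG.lintegral_prod_right'
  have hBl : ∀ z, Measurable fun w => B z w := fun z =>
    hBm.comp (f := fun w : ℂ => (z, w)) (by fun_prop)
  have hBr : ∀ z, Measurable fun w => B w z := fun z =>
    hBm.comp (f := fun w : ℂ => (w, z)) (by fun_prop)
  have hkm : Measurable fun q : ℂ × ℂ => pk q.1 q.2 * B q.1 q.2 := pk_measurable.mul hBm
  have hkl : ∀ z, Measurable fun w => pk z w * B z w := fun z => (pk_left_measurable z).mul (hBl z)
  have hfm : ∀ z w, Measurable fun t => f (xs z t) w := fun z w => by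
    have h1 : Measurable fun t : ℝ => xs z t :=
      hxm.comp (f := fun t : ℝ => (z, t)) (by fun_prop)
    exact h.meas.comp (f := fun t : ℝ => (xs z t, w)) (by fun_prop)
  have hfx : ∀ x, Measurable (f x) := fun x =>
    h.meas.comp (f := fun w : ℂ => (x, w)) (by fun_prop)
  -- the mean value identity
  have I1 : ∀ z ∈ unitDisc, ∫⁻ w, pk z w * B z w ∂hyp = massC * c2 := by
    intro z hz
    have hG2 : Measurable fun q : ℂ × ℝ =>
        ENNReal.ofReal q.2 * ENNReal.ofReal (f (xs z q.2) q.1) :=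
      hG.comp (f := fun q : ℂ × ℝ => ((z, q.1), q.2)) (by fun_prop)
    have e1 : ∀ w, pk z w * B z w =
        ∫⁻ t, pk z w * (ENNReal.ofReal t * ENNReal.ofReal (f (xs z t) w)) ∂lam := by
      intro w
      rw [hB]
      exact (lintegral_const_mul _ (hG2.comp (f := fun t : ℝ => (w, t)) (by fun_prop))).symm
    simp_rw [e1]
    rw [lintegral_lintegral_swap]
    · have e2 : ∀ᵐ t ∂lam, ∫⁻ w, pk z w * (ENNReal.ofReal t * ENNReal.ofReal (f (xs z t) w)) ∂hyp
          = massC * (ENNReal.ofReal t * ENNReal.ofReal t) := by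
        filter_upwards [ae_lam_mem] with t ht
        have e3 : ∀ w, pk z w * (ENNReal.ofReal t * ENNReal.ofReal (f (xs z t) w)) =
            ENNReal.ofReal t * (pk z w * ENNReal.ofReal (f (xs z t) w)) := fun w => by ring
        simp_rw [e3]
        have hmm : Measurable fun w => pk z w * ENNReal.ofReal (f (xs z t) w) :=
          (pk_left_measurable z).mul (hfx _).ennreal_ofReal
        rw [lintegral_const_mul _ hmm,
          mean_value (h.harm _) (hfx _) (fun w hw => h.nonneg (hxab z t).1 (hxab z t).2 hw) hz,
          hxv z hz t ht.1.le ht.2.le]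
        ring
      rw [lintegral_congr_ae e2, lintegral_const_mul _ (by fun_prop), c2]
    · exact (((pk_left_measurable z).comp measurable_fst).mul hG2).aemeasurable
  have hinv : ∀ γ, ∀ z ∈ unitDisc, ∀ w ∈ unitDisc,
      pk (ρ γ z) (ρ γ w) * B (ρ γ z) (ρ γ w) = pk z w * B z w := by
    intro γ z hz w hw
    obtain ⟨α, β, hαβ, hm⟩ := h.fuchs.moebius γ
    have hm' : ∀ z ∈ unitDisc, ρ γ z = moeb α β z := hm
    have e1 : pk (ρ γ z) (ρ γ w) = pk z w := by
      rw [hm' z hz, hm' w hw, pk_moeb hαβ hz hw]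
    have e2 : B (ρ γ z) (ρ γ w) = B z w := by
      rw [hB]
      apply lintegral_congr_ae
      filter_upwards [ae_lam_mem] with t ht
      have hz' := h.fuchs.maps_disc γ z hz
      have hw' := h.fuchs.maps_disc γ w hw
      have l1 : a ≤ σ γ (xs z t) := by
        simpa [h.fa] using (h.mono γ).monotone (hxab z t).1
      have l2 : σ γ (xs z t) ≤ b := by
        simpa [h.fb] using (h.mono γ).monotone (hxab z t).2
      have := h.touch (hxab (ρ γ z) t).1 (hxab (ρ γ z) t).2 l1 l2 hz' hw' (by
        rw [hxv _ hz' t ht.1.le ht.2.le, h.inv γ _ z hz, hxv _ hz t ht.1.le ht.2.le])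
      rw [this, h.inv γ _ w hw]
    rw [e1, e2]
  have hmt := mass_transport h.fuchs hψm hψ (k := fun z w => pk z w * B z w) hkm hinv
  -- the square inequality
  have hsq : ∀ z ∈ unitDisc, ∀ w ∈ unitDisc, B z w + B w z ≤ c2 + c2 ∧
      (B z w + B w z = c2 + c2 → ∀ t ∈ Ioo (0:ℝ) 1, t ≤ f (xs z t) w) := by
    intro z hz w hw
    have := sq_le_and_eq (hfm z w) (hfm w z)
      (fun t _ => ⟨h.nonneg (hxab z t).1 (hxab z t).2 hw, h.le_one (hxab z t).1 (hxab z t).2 hw⟩)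
      (fun t _ => ⟨h.nonneg (hxab w t).1 (hxab w t).2 hz, h.le_one (hxab w t).1 (hxab w t).2 hz⟩)
      (by
        rintro s hs t ht ⟨h1, h2⟩
        have e1 := hxv z hz t ht.1.le ht.2.le
        have e2 := hxv w hw s hs.1.le hs.2.le
        rcases le_total (xs z t) (xs w s) with hl | hl
        · have := h.monotone (hxab z t).1 hl (hxab w s).2 hw
          linarith
        · have := h.monotone (hxab w s).1 hl (hxab z t).2 hz
          linarith)
    rw [hB]
    refine ⟨this.1, fun he => this.2 he ?_⟩
    intro s _ t _ hst
    exact h.monotone (hxab z s).1 (hxmono z hst) (hxab z t).2 hw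
  have hMc : massC * c2 ≠ ⊤ := ENNReal.mul_ne_top massC_lt_top.ne c2_ne_top
  have hle1 : ∀ z ∈ unitDisc, ∀ᵐ w ∂hyp, pk z w * (B z w + B w z) ≤ pk z w * (c2 + c2) := by
    intro z hz
    filter_upwards [ae_hyp_mem] with w hw
    exact mul_le_mul_right (hsq z hz w hw).1 _
  have hsum : ∀ z, ∫⁻ w, pk z w * (B z w + B w z) ∂hyp =
      ∫⁻ w, pk z w * B z w ∂hyp + ∫⁻ w, pk w z * B w z ∂hyp := by
    intro z
    rw [← lintegral_add_left (hkl z)]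
    congr 1; ext w; rw [pk_comm w z]; ring
  have htot : ∀ z ∈ unitDisc, ∫⁻ w, pk z w * (c2 + c2) ∂hyp = massC * c2 + massC * c2 := by
    intro z hz
    rw [lintegral_mul_const _ (pk_left_measurable z), pk_mass hz]; ring
  have hJ : ∀ z ∈ unitDisc, ∫⁻ w, pk w z * B w z ∂hyp ≤ massC * c2 := by
    intro z hz
    have := lintegral_mono_ae (hle1 z hz)
    rw [hsum, htot z hz, I1 z hz] at this
    exact (ENNReal.add_le_add_iff_left hMc).1 this
  have hmt2 : ∫⁻ z, ψ z * ∫⁻ w, pk w z * B w z ∂hyp ∂hyp = ∫⁻ z, ψ z * (massC * c2) ∂hyp := by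
    rw [← hmt]
    exact hyp_congr fun z hz => by rw [I1 z hz]
  have hfin : ∫⁻ z, ψ z * (massC * c2) ∂hyp ≠ ⊤ := by
    rw [lintegral_mul_const _ hψm]; exact ENNReal.mul_ne_top hψt hMc
  have hae : (fun z => ψ z * ∫⁻ w, pk w z * B w z ∂hyp) =ᵐ[hyp] fun z => ψ z * (massC * c2) := by
    apply ae_eq_of_ae_le_of_lintegral_le
    · filter_upwards [ae_hyp_mem] with z hz
      exact mul_le_mul_right (hJ z hz) _
    · rw [hmt2]; exact hfin
    · exact (hψm.mul_const _).aemeasurable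
    · exact hmt2.ge
  obtain ⟨z, hz, hψz, hψz', hEq⟩ : ∃ z ∈ unitDisc, ψ z ≠ 0 ∧ ψ z ≠ ⊤ ∧
      ψ z * ∫⁻ w, pk w z * B w z ∂hyp = ψ z * (massC * c2) := by
    by_contra hcon
    push Not at hcon
    apply weight_ne_zero h.fuchs hψm hψ
    rw [lintegral_eq_zero_iff hψm]
    filter_upwards [ae_hyp_mem, hae, ae_lt_top hψm hψt] with z hz h1 h2
    by_contra h3
    exact hcon z hz h3 h2.ne h1
  have hEq2 := (ENNReal.mul_right_inj hψz hψz').1 hEq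
  have hae2 : (fun w => pk z w * (B z w + B w z)) =ᵐ[hyp] fun w => pk z w * (c2 + c2) := by
    apply ae_eq_of_ae_le_of_lintegral_le (hle1 z hz)
    · rw [hsum, I1 z hz, hEq2]; exact ENNReal.add_ne_top.2 ⟨hMc, hMc⟩
    · exact ((pk_left_measurable z).mul_const _).aemeasurable
    · rw [hsum, I1 z hz, hEq2, htot z hz]
  obtain ⟨x, hx⟩ : ∃ x, x = xs z (1 / 2) := ⟨_, rfl⟩
  have hae3 : ∀ᵐ w ∂hyp, pdist z w < 1 → 1 / 2 ≤ f x w := by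
    filter_upwards [ae_hyp_mem, hae2] with w hw h1 h2
    have : pk z w = 1 := by rw [pk, if_pos h2]
    rw [this, one_mul, one_mul] at h1
    rw [hx]
    exact (hsq z hz w hw).2 h1 _ ⟨by norm_num, by norm_num⟩
  have hae4 := restrict_ac_hyp.ae_le hae3
  have hxz : f x z = 1 / 2 := by rw [hx]; exact hxv z hz _ (by norm_num) (by norm_num)
  have hlt : ∀ w ∈ unitDisc, pdist z w < 1 → 1 / 2 ≤ f x w := by
    intro w hw hd
    by_contra hcon
    push Not at hcon
    have hev : ∀ᶠ u in nhds w, u ∈ unitDisc ∧ pdist z u < 1 ∧ f x u < 1 / 2 := by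
      have hn := isOpen_unitDisc.mem_nhds hw
      have c1 := ((pdist_continuousOn hz).continuousAt hn).eventually (gt_mem_nhds hd)
      have c2 := ((h.harm x).continuousOn.continuousAt hn).eventually (gt_mem_nhds hcon)
      filter_upwards [hn, c1, c2] with u h1 h2 h3 using ⟨h1, h2, h3⟩
    have h0 : volume {u | u ∈ unitDisc ∧ pdist z u < 1 ∧ f x u < 1 / 2} = 0 := by
      have h5 := (ae_restrict_iff' isOpen_unitDisc.measurableSet).1 hae4
      refine measure_mono_null ?_ h5
      rintro u ⟨h1, h2, h3⟩ h4
      exact absurd (h4 h1 h2) (not_le.2 h3)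
    have hpos := MeasureTheory.Measure.measure_pos_of_mem_nhds volume hev
    exact hpos.ne' h0
  have hconst := (h.harm x).const_of_isLocalMin hz (by
    have hn := isOpen_unitDisc.mem_nhds hz
    have hd : pdist z z < 1 := by simp [pdist]
    filter_upwards [hn, ((pdist_continuousOn hz).continuousAt hn).eventually (gt_mem_nhds hd)]
      with w h1 h2
    rw [hxz]; exact hlt w h1 h2)
  refine h.nc x ?_ ?_ ⟨_, hconst⟩
  · refine lt_of_le_of_ne (by rw [hx]; exact (hxab _ _).1) ?_
    rintro rfl
    rw [h.h0 z hz] at hxz; norm_num at hxz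
  · refine lt_of_le_of_ne (by rw [hx]; exact (hxab _ _).2) ?_
    rintro rfl
    rw [h.h1 z hz] at hxz; norm_num at hxz
end

/-! ### Reduction to the core argument -/

section
variable {Γ : Type*} [Group Γ] {ρ : Γ → ℂ → ℂ} {σ : Γ → unitInterval → unitInterval}
    {f : unitInterval → ℂ → ℝ}

theorem zero_mem_unitDisc : (0:ℂ) ∈ unitDisc := by simp [mem_unitDisc]

theorem rho_inv (h : IsCocompactFuchsian Γ ρ) (γ : Γ) {z : ℂ} (hz : z ∈ unitDisc) :
    ρ γ (ρ γ⁻¹ z) = z := by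
  rw [← h.mul_act _ _ z hz, mul_inv_cancel, h.one_act z hz]

theorem rho_continuousOn (h : IsCocompactFuchsian Γ ρ) (γ : Γ) : ContinuousOn (ρ γ) unitDisc := by
  obtain ⟨α, β, hαβ, hm⟩ := h.moebius γ
  exact (moeb_differentiableOn hαβ).continuousOn.congr hm

theorem sig_inv (h : IsActionByHomeomorphisms Γ unitInterval σ) (γ : Γ) (x : unitInterval) :
    σ γ (σ γ⁻¹ x) = x := by
  rw [← h.mul_act, mul_inv_cancel, h.one_act]

theorem sig_inv' (h : IsActionByHomeomorphisms Γ unitInterval σ) (γ : Γ) (x : unitInterval) :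
    σ γ⁻¹ (σ γ x) = x := by
  rw [← h.mul_act, inv_mul_cancel, h.one_act]

theorem sig_mono (h : IsActionByHomeomorphisms Γ unitInterval σ) (γ : Γ) :
    StrictMono (σ γ) ∨ StrictAnti (σ γ) := by
  apply (h.continuous_act γ).strictMono_of_inj
  intro x y hxy
  rw [← sig_inv' h γ x, hxy, sig_inv' h γ y]

/-- Affine renormalisation of a family. -/
theorem Fam.affine (h : Fam Γ ρ σ f) (p q : ℝ) : Fam Γ ρ σ (fun x z => p * f x z + q) where
  fuchs := h.fuchs
  cont := (continuousOn_const.mul h.cont).add continuousOn_const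
  meas := (h.meas.const_mul p).add_const q
  harm x := ((h.harm x).smul p).add (Harm.const q)
  inv l x z hz := by rw [h.inv l x z hz]

/-- The parameters of constant functions. -/
def cset (f : unitInterval → ℂ → ℝ) : Set unitInterval := {x | ∀ z ∈ unitDisc, f x z = f x 0}

theorem Fam.isClosed_cset (h : Fam Γ ρ σ f) : IsClosed (cset f) := by
  have : cset f = ⋂ z ∈ unitDisc, {x | f x z = f x 0} := by
    ext x; simp [cset]
  rw [this]
  exact isClosed_biInter fun z hz =>
    isClosed_eq (h.cont_left hz) (h.cont_left zero_mem_unitDisc)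

theorem Fam.cset_val (h : Fam Γ ρ σ f) {x : unitInterval} (hx : x ∈ cset f) (γ : Γ) {z : ℂ}
    (hz : z ∈ unitDisc) : f (σ γ x) z = f x 0 := by
  rw [← rho_inv h.fuchs γ hz, h.inv γ x _ (h.fuchs.maps_disc _ z hz)]
  exact hx _ (h.fuchs.maps_disc _ z hz)

theorem Fam.cset_inv (h : Fam Γ ρ σ f) {x : unitInterval} (hx : x ∈ cset f) (γ : Γ) :
    σ γ x ∈ cset f := fun z hz => by
  rw [h.cset_val hx γ hz, h.cset_val hx γ zero_mem_unitDisc]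

theorem Fam.exists_min (h : Fam Γ ρ σ f) {Y : Set unitInterval} (hYc : IsClosed Y)
    (hYn : Y.Nonempty) (hYi : ∀ γ, ∀ y ∈ Y, σ γ y ∈ Y) :
    ∃ y ∈ Y, y ∈ cset f ∧ ∀ y' ∈ Y, ∀ z ∈ unitDisc, f y 0 ≤ f y' z := by
  obtain ⟨K, hKD, hK, hcov⟩ := h.fuchs.cocompact
  obtain ⟨y1, hy1⟩ := hYn
  obtain ⟨γ1, hγ1⟩ := hcov 0 zero_mem_unitDisc
  have hc : ContinuousOn (fun q : unitInterval × ℂ => f q.1 q.2) (Y ×ˢ K) :=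
    h.cont.mono (prod_mono (subset_univ _) hKD)
  obtain ⟨⟨y0, z0⟩, ⟨hy0, hz0⟩, hmin⟩ :=
    (hYc.isCompact.prod hK).exists_isMinOn ⟨(y1, _), hy1, hγ1⟩ hc
  have key : ∀ y' ∈ Y, ∀ z ∈ unitDisc, f y0 z0 ≤ f y' z := by
    intro y' hy' z hz
    obtain ⟨γ, hγ⟩ := hcov z hz
    have h1 : f y0 z0 ≤ f (σ γ y') (ρ γ z) :=
      hmin (a := (σ γ y', ρ γ z)) ⟨hYi γ y' hy', hγ⟩
    rwa [h.inv γ y' z hz] at h1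
  simp only at hy0 hz0
  have hconst := (h.harm y0).const_of_isLocalMin (hKD hz0) (by
    filter_upwards [isOpen_unitDisc.mem_nhds (hKD hz0)] with z hz
    exact key y0 hy0 z hz)
  refine ⟨y0, hy0, ?_, ?_⟩
  · intro z hz
    rw [hconst z hz, hconst 0 zero_mem_unitDisc]
  · intro y' hy' z hz
    rw [hconst 0 zero_mem_unitDisc]
    exact key y' hy' z hz

theorem Fam.exists_max (h : Fam Γ ρ σ f) {Y : Set unitInterval} (hYc : IsClosed Y)
    (hYn : Y.Nonempty) (hYi : ∀ γ, ∀ y ∈ Y, σ γ y ∈ Y) :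
    ∃ y ∈ Y, y ∈ cset f ∧ ∀ y' ∈ Y, ∀ z ∈ unitDisc, f y' z ≤ f y 0 := by
  obtain ⟨y, hy, hc, hm⟩ := (h.affine (-1) 0).exists_min hYc hYn hYi
  refine ⟨y, hy, fun z hz => ?_, fun y' hy' z hz => ?_⟩
  · have := hc z hz
    simp only at this
    linarith
  · have := hm y' hy' z hz
    linarith

theorem Fam.endpoints (h : Fam Γ ρ σ f) (hσ : IsActionByHomeomorphisms Γ unitInterval σ) :
    (0 : unitInterval) ∈ cset f ∧ (1 : unitInterval) ∈ cset f := by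
  have hYi : ∀ γ, ∀ y ∈ ({0, 1} : Set unitInterval), σ γ y ∈ ({0, 1} : Set unitInterval) := by
    intro γ y hy
    rcases sig_mono hσ γ with hm | hm
    · rcases hy with rfl | rfl
      · left
        apply le_antisymm _ unitInterval.nonneg'
        conv_rhs => rw [← sig_inv hσ γ 0]
        exact hm.monotone unitInterval.nonneg'
      · right
        apply le_antisymm unitInterval.le_one'
        conv_lhs => rw [← sig_inv hσ γ 1]
        exact hm.monotone unitInterval.le_one'
    · rcases hy with rfl | rfl
      · right
        apply le_antisymm unitInterval.le_one'
        conv_lhs => rw [← sig_inv hσ γ 1]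
        exact hm.antitone unitInterval.nonneg'
      · left
        apply le_antisymm _ unitInterval.nonneg'
        conv_rhs => rw [← sig_inv hσ γ 0]
        exact hm.antitone unitInterval.le_one'
  have hYc : IsClosed ({0, 1} : Set unitInterval) := (toFinite _).isClosed
  obtain ⟨y, hy, hyc, hmin⟩ := h.exists_min hYc ⟨0, by simp⟩ hYi
  obtain ⟨y', hy', hyc', hmax⟩ := h.exists_max hYc ⟨0, by simp⟩ hYi
  by_cases hyy : y = y'
  · subst hyy
    have hall : ∀ u ∈ ({0, 1} : Set unitInterval), ∀ z ∈ unitDisc, f u z = f y 0 :=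
      fun u hu z hz => le_antisymm (hmax u hu z hz) (hmin u hu z hz)
    exact ⟨fun z hz => by rw [hall 0 (by simp) z hz, hall 0 (by simp) 0 zero_mem_unitDisc],
      fun z hz => by rw [hall 1 (by simp) z hz, hall 1 (by simp) 0 zero_mem_unitDisc]⟩
  · rcases hy with rfl | rfl <;> rcases hy' with rfl | rfl
    · exact absurd rfl hyy
    · exact ⟨hyc, hyc'⟩
    · exact ⟨hyc', hyc⟩
    · exact absurd rfl hyy

/-- Stabiliser of two points. -/
def stab (hσ : IsActionByHomeomorphisms Γ unitInterval σ) (a b : unitInterval) : Subgroup Γ where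
  carrier := {γ | σ γ a = a ∧ σ γ b = b}
  one_mem' := ⟨hσ.one_act a, hσ.one_act b⟩
  mul_mem' := by
    rintro x y ⟨h1, h2⟩ ⟨h3, h4⟩
    exact ⟨by rw [hσ.mul_act, h3, h1], by rw [hσ.mul_act, h4, h2]⟩
  inv_mem' := by
    rintro x ⟨h1, h2⟩
    refine ⟨?_, ?_⟩
    · conv_lhs => rw [← h1]
      exact sig_inv' hσ x a
    · conv_lhs => rw [← h2]
      exact sig_inv' hσ x b

/-- A gap of the set of constant parameters. -/
structure Gap (f : unitInterval → ℂ → ℝ) (a b : unitInterval) : Prop where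
  hab : a < b
  ha : a ∈ cset f
  hb : b ∈ cset f
  gap : ∀ y ∈ cset f, y ≤ a ∨ b ≤ y

theorem Gap.act {a b : unitInterval} (g : Gap f a b) (h : Fam Γ ρ σ f)
    (hσ : IsActionByHomeomorphisms Γ unitInterval σ) (γ : Γ) {y : unitInterval} (hy : y ∈ cset f) :
    (y ≤ σ γ a ∧ y ≤ σ γ b) ∨ (σ γ a ≤ y ∧ σ γ b ≤ y) := by
  have h1 := g.gap _ (h.cset_inv hy γ⁻¹)
  have e := sig_inv hσ γ y
  rcases sig_mono hσ γ with hm | hm <;> rcases h1 with h1 | h1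
  · left; constructor
    · conv_lhs => rw [← e]
      exact hm.monotone h1
    · conv_lhs => rw [← e]
      exact hm.monotone (h1.trans g.hab.le)
  · right; constructor
    · conv_rhs => rw [← e]
      exact hm.monotone (g.hab.le.trans h1)
    · conv_rhs => rw [← e]
      exact hm.monotone h1
  · right; constructor
    · conv_rhs => rw [← e]
      exact hm.antitone h1
    · conv_rhs => rw [← e]
      exact hm.antitone (h1.trans g.hab.le)
  · left; constructor
    · conv_lhs => rw [← e]
      exact hm.antitone (g.hab.le.trans h1)
    · conv_lhs => rw [← e]
      exact hm.antitone h1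

theorem Gap.between {a b : unitInterval} (g : Gap f a b)
    (hσ : IsActionByHomeomorphisms Γ unitInterval σ) (γ : Γ) {x : unitInterval} (hx : x ∈ Icc a b) :
    (σ γ a ≤ σ γ x ∧ σ γ x ≤ σ γ b) ∨ (σ γ b ≤ σ γ x ∧ σ γ x ≤ σ γ a) := by
  rcases sig_mono hσ γ with hm | hm
  · exact Or.inl ⟨hm.monotone hx.1, hm.monotone hx.2⟩
  · exact Or.inr ⟨hm.antitone hx.2, hm.antitone hx.1⟩

theorem Gap.ne {a b : unitInterval} (g : Gap f a b) (h : Fam Γ ρ σ f)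
    (hσ : IsActionByHomeomorphisms Γ unitInterval σ) : f a 0 ≠ f b 0 := by
  intro hcd
  obtain ⟨E, hE⟩ : ∃ E : Set unitInterval, E = {y | ∃ γ, y = σ γ a ∨ y = σ γ b} := ⟨_, rfl⟩
  obtain ⟨U, hU⟩ : ∃ U : Set unitInterval, U = {y | ∃ γ, ∃ x ∈ Icc a b, y = σ γ x} := ⟨_, rfl⟩
  have hYi : ∀ γ, ∀ y ∈ closure U, σ γ y ∈ closure U := by
    intro γ y hy
    refine map_mem_closure (hσ.continuous_act γ) hy ?_
    rw [hU]
    rintro _ ⟨γ', x, hx, rfl⟩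
    exact ⟨γ * γ', x, hx, by rw [hσ.mul_act]⟩
  have hsub : ∀ x ∈ Icc a b, x ∈ closure U := fun x hx =>
    subset_closure (by rw [hU]; exact ⟨1, x, hx, (hσ.one_act x).symm⟩)
  have hval : ∀ y ∈ closure U, y ∈ cset f → f y 0 = f a 0 := by
    intro y hy hyc
    have hyE : y ∈ closure E := by
      rw [Metric.mem_closure_iff] at hy ⊢
      intro ε hε
      obtain ⟨u, hu, hd⟩ := hy ε hε
      rw [hU] at hu
      obtain ⟨γ, x, hx, rfl⟩ := hu
      have h1 := g.act h hσ γ hyc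
      have h2 := g.between hσ γ hx
      rw [Subtype.dist_eq, Real.dist_eq, abs_lt] at hd
      simp only [← Subtype.coe_le_coe] at h1 h2
      have e1 : σ γ a ∈ E := by rw [hE]; exact ⟨γ, Or.inl rfl⟩
      have e2 : σ γ b ∈ E := by rw [hE]; exact ⟨γ, Or.inr rfl⟩
      have h3 : dist y (σ γ a) < ε ∨ dist y (σ γ b) < ε := by
        simp only [Subtype.dist_eq, Real.dist_eq, abs_lt]
        rcases h1 with ⟨h1, h1'⟩ | ⟨h1, h1'⟩ <;> rcases h2 with ⟨h2, h2'⟩ | ⟨h2, h2'⟩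
        · left; constructor <;> linarith
        · right; constructor <;> linarith
        · right; constructor <;> linarith
        · left; constructor <;> linarith
      rcases h3 with h3 | h3
      · exact ⟨_, e1, h3⟩
      · exact ⟨_, e2, h3⟩
    have hcl : IsClosed {y | f y 0 = f a 0} :=
      isClosed_eq (h.cont_left zero_mem_unitDisc) continuous_const
    refine closure_minimal ?_ hcl hyE
    rw [hE]
    rintro _ ⟨γ, rfl | rfl⟩
    · exact h.cset_val g.ha γ zero_mem_unitDisc
    · exact (h.cset_val g.hb γ zero_mem_unitDisc).trans hcd.symm
  have hne : (closure U).Nonempty := ⟨a, hsub a ⟨le_rfl, g.hab.le⟩⟩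
  obtain ⟨y, hy, hyc, hmin⟩ := h.exists_min isClosed_closure hne hYi
  obtain ⟨y', hy', hyc', hmax⟩ := h.exists_max isClosed_closure hne hYi
  obtain ⟨x, hx1, hx2⟩ := exists_between g.hab
  have hx := hsub x ⟨hx1.le, hx2.le⟩
  have hall : ∀ z ∈ unitDisc, f x z = f a 0 := by
    intro z hz
    have h1 := hmin x hx z hz
    have h2 := hmax x hx z hz
    rw [hval y hy hyc] at h1
    rw [hval y' hy' hyc'] at h2
    exact le_antisymm h2 h1
  have hxc : x ∈ cset f := fun z hz => by rw [hall z hz, hall 0 zero_mem_unitDisc]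
  rcases g.gap x hxc with h1 | h1
  · exact absurd hx1 (not_lt.2 h1)
  · exact absurd hx2 (not_lt.2 h1)

theorem Gap.exists_sep {a b : unitInterval} (g : Gap f a b) (h : Fam Γ ρ σ f)
    (hσ : IsActionByHomeomorphisms Γ unitInterval σ) : ∃ δ > 0, ∀ γ γ' : Γ,
    dist (σ γ a, σ γ b) (σ γ' a, σ γ' b) < δ → σ γ a = σ γ' a ∧ σ γ b = σ γ' b := by
  have hne := g.ne h hσ
  have huc : UniformContinuous fun x => f x 0 :=
    CompactSpace.uniformContinuous_of_continuous (h.cont_left zero_mem_unitDisc)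
  obtain ⟨δ, hδ, hd⟩ := Metric.uniformContinuous_iff.1 huc (dist (f a 0) (f b 0)) (dist_pos.2 hne)
  have hsep : ∀ γ, δ ≤ dist (σ γ a) (σ γ b) := by
    intro γ
    by_contra hcon
    push Not at hcon
    have := hd hcon
    rw [h.cset_val g.ha γ zero_mem_unitDisc, h.cset_val g.hb γ zero_mem_unitDisc] at this
    exact lt_irrefl _ this
  refine ⟨δ, hδ, ?_⟩
  intro γ γ' hdist
  rw [Prod.dist_eq, max_lt_iff] at hdist
  have s1 := hsep γ
  have s2 := hsep γ'
  have a1 := g.act h hσ γ (h.cset_inv g.ha γ')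
  have a2 := g.act h hσ γ (h.cset_inv g.hb γ')
  have a3 := g.act h hσ γ' (h.cset_inv g.ha γ)
  have a4 := g.act h hσ γ' (h.cset_inv g.hb γ)
  simp only [Subtype.dist_eq, Real.dist_eq, abs_lt, le_abs, ← Subtype.coe_le_coe] at *
  rw [Subtype.ext_iff, Subtype.ext_iff]
  obtain ⟨⟨d1, d2⟩, d3, d4⟩ := hdist
  rcases s1 with s1 | s1 <;> rcases s2 with s2 | s2 <;> rcases a1 with ⟨a1, a1'⟩ | ⟨a1, a1'⟩ <;>
    rcases a2 with ⟨a2, a2'⟩ | ⟨a2, a2'⟩ <;> rcases a3 with ⟨a3, a3'⟩ | ⟨a3, a3'⟩ <;>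
    rcases a4 with ⟨a4, a4'⟩ | ⟨a4, a4'⟩ <;> first | (exfalso; linarith) | (constructor <;> linarith)

theorem Gap.fuchs_stab {a b : unitInterval} (g : Gap f a b) (h : Fam Γ ρ σ f)
    (hσ : IsActionByHomeomorphisms Γ unitInterval σ) :
    IsCocompactFuchsian (stab hσ a b) (fun l => ρ (l : Γ)) where
  one_act := h.fuchs.one_act
  mul_act l₁ l₂ := h.fuchs.mul_act l₁ l₂
  maps_disc l := h.fuchs.maps_disc l
  moebius l := h.fuchs.moebius l
  faithful l hl := Subtype.ext (h.fuchs.faithful l hl)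
  properly_discontinuous K hKD hK := by
    have h1 := Set.Finite.preimage (f := ((↑) : stab hσ a b → Γ)) Subtype.val_injective.injOn
      (h.fuchs.properly_discontinuous K hKD hK)
    exact h1
  cocompact := by
    obtain ⟨K, hKD, hK, hcov⟩ := h.fuchs.cocompact
    obtain ⟨δ, hδ, hsep⟩ := g.exists_sep h hσ
    obtain ⟨t, htf, htc⟩ := Metric.totallyBounded_iff.1
      (isCompact_univ (X := unitInterval × unitInterval)).totallyBounded (δ / 2) (half_pos hδ)
    have hr : ∀ y : unitInterval × unitInterval, ∃ r : Γ,
        (∃ γ : Γ, dist (σ γ a, σ γ b) y < δ / 2) → dist (σ r a, σ r b) y < δ / 2 := by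
      intro y
      by_cases hy : ∃ γ : Γ, dist (σ γ a, σ γ b) y < δ / 2
      · obtain ⟨γ, hγ⟩ := hy
        exact ⟨γ, fun _ => hγ⟩
      · exact ⟨1, fun hc => absurd hc hy⟩
    choose r hr using hr
    refine ⟨⋃ y ∈ t, ρ (r y)⁻¹ '' K, ?_, ?_, ?_⟩
    · refine iUnion₂_subset fun y _ => ?_
      rintro _ ⟨z, hz, rfl⟩
      exact h.fuchs.maps_disc _ z (hKD hz)
    · exact htf.isCompact_biUnion fun y _ =>
        hK.image_of_continuousOn ((rho_continuousOn h.fuchs _).mono hKD)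
    · intro z hz
      obtain ⟨γ, hγ⟩ := hcov z hz
      obtain ⟨y, hyt, hy⟩ := mem_iUnion₂.1 (htc (mem_univ (σ γ a, σ γ b)))
      have h1 : dist (σ γ a, σ γ b) y < δ / 2 := hy
      have h2 := hr y ⟨γ, h1⟩
      have h3 := hsep γ (r y) (by
        have := dist_triangle_right (σ γ a, σ γ b) (σ (r y) a, σ (r y) b) y
        linarith)
      refine ⟨⟨(r y)⁻¹ * γ, ?_, ?_⟩, ?_⟩
      · rw [hσ.mul_act, h3.1, sig_inv' hσ]
      · rw [hσ.mul_act, h3.2, sig_inv' hσ]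
      · simp only
        rw [h.fuchs.mul_act _ _ z hz]
        exact mem_iUnion₂.2 ⟨y, hyt, _, hγ, rfl⟩

theorem Gap.false {a b : unitInterval} (g : Gap f a b) (h : Fam Γ ρ σ f)
    (hσ : IsActionByHomeomorphisms Γ unitInterval σ) : False := by
  have hne := g.ne h hσ
  have hd : f b 0 - f a 0 ≠ 0 := sub_ne_zero.2 hne.symm
  have hA := h.affine (f b 0 - f a 0)⁻¹ (-((f b 0 - f a 0)⁻¹ * f a 0))
  have hcore : Core (stab hσ a b) (fun l => ρ (l : Γ)) (fun l => σ (l : Γ))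
      (fun x z => (f b 0 - f a 0)⁻¹ * f x z + (-((f b 0 - f a 0)⁻¹ * f a 0))) a b :=
    { fuchs := g.fuchs_stab h hσ
      cont := hA.cont
      meas := hA.meas
      harm := hA.harm
      inv := fun l => hA.inv l
      mono := by
        intro l
        rcases sig_mono hσ (l : Γ) with hm | hm
        · exact hm
        · exfalso
          have h1 := hm g.hab
          rw [l.2.1, l.2.2] at h1
          exact lt_asymm h1 g.hab
      hab := g.hab
      fa := fun l => l.2.1
      fb := fun l => l.2.2
      h0 := fun z hz => by rw [g.ha z hz]; ring
      h1 := fun z hz => by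
        rw [g.hb z hz, ← mul_neg, ← mul_add, ← sub_eq_add_neg, inv_mul_cancel₀ hd]
      nc := by
        rintro x hax hxb ⟨c, hc⟩
        have hxc : x ∈ cset f := by
          intro z hz
          have h1 := hc z hz
          have h2 := hc 0 zero_mem_unitDisc
          have h3 : (f b 0 - f a 0)⁻¹ * f x z = (f b 0 - f a 0)⁻¹ * f x 0 := by linarith
          exact mul_left_cancel₀ (inv_ne_zero hd) h3
        rcases g.gap x hxc with h1 | h1
        · exact absurd hax (not_lt.2 h1)
        · exact absurd hxb (not_lt.2 h1) }
  exact hcore.false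

theorem Fam.const (h : Fam Γ ρ σ f) (hσ : IsActionByHomeomorphisms Γ unitInterval σ)
    (x : unitInterval) : x ∈ cset f := by
  by_contra hx
  obtain ⟨h0, h1⟩ := h.endpoints hσ
  obtain ⟨a, ⟨hac, hax⟩, ham⟩ := (h.isClosed_cset.inter isClosed_Iic).isCompact.exists_isGreatest
    (⟨0, h0, unitInterval.nonneg'⟩ : (cset f ∩ Iic x).Nonempty)
  obtain ⟨b, ⟨hbc, hbx⟩, hbm⟩ := (h.isClosed_cset.inter isClosed_Ici).isCompact.exists_isLeast
    (⟨1, h1, unitInterval.le_one'⟩ : (cset f ∩ Ici x).Nonempty)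
  have hax' : a < x := lt_of_le_of_ne hax (by rintro rfl; exact hx hac)
  have hbx' : x < b := lt_of_le_of_ne hbx (by rintro rfl; exact hx hbc)
  have g : Gap f a b := ⟨hax'.trans hbx', hac, hbc, fun y hy => by
    rcases le_total y x with h2 | h2
    · exact Or.inl (ham ⟨hy, h2⟩)
    · exact Or.inr (hbm ⟨hy, h2⟩)⟩
  exact g.false h hσ
end

open Classical in
/-- Extension of a map into functions on the disc by zero. -/
def ext0 (F : unitInterval → C(↥unitDisc, ℝ)) (x : unitInterval) (z : ℂ) : ℝ :=
  if hz : z ∈ unitDisc then F x ⟨z, hz⟩ else 0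

theorem ext0_coe (F : unitInterval → C(↥unitDisc, ℝ)) (x : unitInterval) (z : ↥unitDisc) :
    ext0 F x z = F x z := by
  simp [ext0]

instance : LocallyCompactSpace ↥unitDisc := isOpen_unitDisc.locallyCompactSpace

theorem ext0_cont {F : unitInterval → C(↥unitDisc, ℝ)} (hF : Continuous F) :
    ContinuousOn (fun q : unitInterval × ℂ => ext0 F q.1 q.2) (univ ×ˢ unitDisc) := by
  have h1 : Continuous fun p : unitInterval × ↥unitDisc => F p.1 p.2 := by fun_prop
  rw [continuousOn_iff_continuous_restrict]
  have h2 : Continuous fun q : ↥((univ : Set unitInterval) ×ˢ unitDisc) =>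
      ((q.1.1, ⟨q.1.2, q.2.2⟩) : unitInterval × ↥unitDisc) := by fun_prop
  refine (h1.comp h2).congr fun q => ?_
  exact (ext0_coe F q.1.1 ⟨q.1.2, q.2.2⟩).symm

theorem ext0_meas {F : unitInterval → C(↥unitDisc, ℝ)} (hF : Continuous F) :
    Measurable (fun q : unitInterval × ℂ => ext0 F q.1 q.2) := by
  classical
  have hs : MeasurableSet ((univ : Set unitInterval) ×ˢ unitDisc) :=
    MeasurableSet.univ.prod isOpen_unitDisc.measurableSet
  have := (ext0_cont hF).measurable_piecewise (g := fun _ => (0:ℝ)) continuousOn_const hs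
  convert this using 1
  ext q
  by_cases hq : q.2 ∈ unitDisc
  · simp [piecewise, hq]
  · simp [piecewise, hq, ext0]

/-- **Corollary 1.4 (X = [0,1]).** For a cocompact Fuchsian group `Γ` acting on `X₀` by
`γ·h = h ∘ γ⁻¹` and on the interval `[0,1]` by homeomorphisms, every continuous
`Γ`-equivariant map `F : [0,1] → X₀` takes values in the constant functions. -/
theorem equivariant_maps_into_X0_are_constant_interval
    {Γ : Type*} [Group Γ] (ρ : Γ → ℂ → ℂ) (hΓ : IsCocompactFuchsian Γ ρ)
    (σ : Γ → unitInterval → unitInterval) (hσ : IsActionByHomeomorphisms Γ unitInterval σ)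
    (F : unitInterval → C(↥unitDisc, ℝ))
    (hFcont : Continuous F)
    (hFX₀ : ∀ x : unitInterval, F x ∈ X₀)
    (hFequiv : ∀ (γ : Γ) (x : unitInterval) (z w : ↥unitDisc),
      (w : ℂ) = ρ γ⁻¹ (z : ℂ) → F (σ γ x) z = F x w) :
    ∀ (x : unitInterval) (z w : ↥unitDisc), F x z = F x w := by
  have hfam : Fam Γ ρ σ (ext0 F) :=
    { fuchs := hΓ
      cont := ext0_cont hFcont
      meas := ext0_meas hFcont
      harm := fun x => harm_of_isHarmonicDiscFun (hFX₀ x).1 (ext0_coe F x)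
      inv := by
        intro γ x z hz
        have hz' := hΓ.maps_disc γ z hz
        have h1 := hFequiv γ x ⟨ρ γ z, hz'⟩ ⟨z, hz⟩ (by
          simp only
          rw [← hΓ.mul_act _ _ z hz, inv_mul_cancel, hΓ.one_act z hz])
        rw [← ext0_coe, ← ext0_coe] at h1
        exact h1 }
  intro x z w
  have hc := hfam.const hσ x
  rw [← ext0_coe, ← ext0_coe, hc z z.2, hc w w.2]
end
end

section
/- (Key analytic step in the proof of Proposition 10.1: the transversal derivative of a Lipschitz harmonic family is harmonic.) Let D ⊆ ℂ be a connected open set and let φ : D × [0,1] → ℝ satisfy: (i) for each t ∈ [0,1], z ↦ φ(z,t) is harmonic on D; (ii) φ(z,s) ≤ φ(z,t) for all z ∈ D whenever s ≤ t; (iii) φ is Lipschitz on E × [0,1] for every compact set E ⊆ D. Then for Lebesgue-almost every t ∈ [0,1] the following holds: the partial derivative ∂φ/∂t(z,t) exists for Lebesgue-almost every z ∈ D, and there is a nonnegative harmonic function h on D such that ∂φ/∂t(z,t) = h(z) for Lebesgue-almost every z ∈ D. -/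
open Metric Set Filter

noncomputable section

open MeasureTheory

lemma HarmonicOnSet.harmonicOnNhd {f : ℂ → ℝ} {U : Set ℂ} (hf : HarmonicOnSet f U) :
    InnerProductSpace.HarmonicOnNhd f U := by
  intro z hz
  obtain ⟨r, hr, -, g, hg, hfg⟩ := hf z hz
  have hball : Metric.ball z r ∈ nhds z := Metric.ball_mem_nhds z hr
  have h1 : AnalyticAt ℂ g z := hg.analyticAt hball
  refine (InnerProductSpace.harmonicAt_congr_nhds ?_).2 h1.harmonicAt_re
  filter_upwards [hball] with w hw using hfg w hw

lemma harnack_bound {u : ℂ → ℝ} {c w : ℂ} {R L : ℝ}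
    (hu : InnerProductSpace.HarmonicOnNhd u (Metric.closedBall c R))
    (hu0 : ∀ z ∈ Metric.closedBall c R, 0 ≤ u z) (huL : u c ≤ L)
    (hw : w ∈ Metric.ball c R) :
    |u w - u c| ≤ 2 * ‖w - c‖ / (R - ‖w - c‖) * L := by
  have hR : 0 < R := Metric.pos_of_mem_ball hw
  have hr : ‖w - c‖ < R := mem_ball_iff_norm.1 hw
  have hr0 := norm_nonneg (w - c)
  have hcont : ContinuousOn u (Metric.sphere c |R|) := by
    rw [abs_of_pos hR]
    intro z hz
    exact (hu z (Metric.sphere_subset_closedBall hz)).1.continuousAt.continuousWithinAt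
  have hI : CircleIntegrable u c R := hcont.circleIntegrable'
  have hk : ContinuousOn (Complex.re ∘ herglotzRieszKernel c w) (Metric.sphere c |R|) :=
    Complex.continuous_re.comp_continuousOn (continuousOn_herglotzRieszKernel_sphere hw)
  have hPI : CircleIntegrable ((Complex.re ∘ herglotzRieszKernel c w) • u) c R :=
    (hk.smul hcont).circleIntegrable'
  have hP := hu.circleAverage_re_herglotzRieszKernel_smul hw
  have hM : Real.circleAverage u c R = u c :=
    InnerProductSpace.HarmonicOnNhd.circleAverage_eq (by rwa [abs_of_pos hR])
  have hKI : ∀ K : ℝ, CircleIntegrable (K • u) c R := fun K => hI.const_smul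
  have up : u w ≤ (R + ‖w - c‖) / (R - ‖w - c‖) * u c := by
    rw [← hP]
    rw [← hM]
    rw [← smul_eq_mul, ← Real.circleAverage_smul]
    refine Real.circleAverage_mono hPI (hKI _) ?_
    intro x hx
    rw [abs_of_pos hR] at hx
    exact mul_le_mul_of_nonneg_right (re_herglotzRieszKernel_le hx hw)
      (hu0 x (Metric.sphere_subset_closedBall hx))
  have lo : (R - ‖w - c‖) / (R + ‖w - c‖) * u c ≤ u w := by
    rw [← hP]
    rw [← hM]
    rw [← smul_eq_mul, ← Real.circleAverage_smul]
    refine Real.circleAverage_mono (hKI _) hPI ?_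
    intro x hx
    rw [abs_of_pos hR] at hx
    exact mul_le_mul_of_nonneg_right (le_re_herglotzRieszKernel hx hw)
      (hu0 x (Metric.sphere_subset_closedBall hx))
  have hc0 : 0 ≤ u c := hu0 c (Metric.mem_closedBall_self hR.le)
  set r := ‖w - c‖
  have e1 : (R + r) / (R - r) = 1 + 2 * r / (R - r) := by
    have : R - r ≠ 0 := by linarith
    field_simp; ring
  have e2 : (R - r) / (R + r) = 1 - 2 * r / (R + r) := by
    have : R + r ≠ 0 := by linarith
    field_simp; ring
  have e3 : 2 * r / (R + r) ≤ 2 * r / (R - r) := by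
    apply div_le_div_of_nonneg_left <;> linarith
  have e4 : 0 ≤ 2 * r / (R - r) := div_nonneg (by linarith) (by linarith)
  have e5 := mul_le_mul_of_nonneg_left huL e4
  have e6 := mul_le_mul_of_nonneg_right e3 hc0
  rw [e1] at up
  rw [e2] at lo
  rw [abs_le]
  constructor <;> nlinarith

lemma limit_re {u : ℕ → ℂ → ℝ} {h : ℂ → ℝ} {c : ℂ} {R L : ℝ} (hR : 0 < R)
    (hu : ∀ n, InnerProductSpace.HarmonicOnNhd (u n) (Metric.closedBall c R))
    (hL : ∀ n, ∀ z ∈ Metric.closedBall c R, |u n z| ≤ L)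
    (hlim : ∀ z ∈ Metric.closedBall c R, Tendsto (fun n => u n z) atTop (nhds (h z))) :
    ∃ g : ℂ → ℂ, DifferentiableOn ℂ g (Metric.ball c R) ∧
      ∀ w ∈ Metric.ball c R, h w = (g w).re := by
  have hmem : ∀ θ, circleMap c R θ ∈ Metric.closedBall c R := fun θ =>
    circleMap_mem_closedBall c hR.le θ
  have hcontn : ∀ n, ContinuousOn (u n) (Metric.sphere c |R|) := by
    intro n z hz
    rw [abs_of_pos hR] at hz
    exact (hu n z (Metric.sphere_subset_closedBall hz)).1.continuousAt.continuousWithinAt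
  have hmeasn : ∀ n, AEStronglyMeasurable (fun θ => u n (circleMap c R θ))
      (volume.restrict (Set.uIoc 0 (2 * Real.pi))) := fun n =>
    (intervalIntegrable_iff.1 (hcontn n).circleIntegrable').aestronglyMeasurable
  have hmeas : AEStronglyMeasurable (fun θ => h (circleMap c R θ))
      (volume.restrict (Set.uIoc 0 (2 * Real.pi))) :=
    aestronglyMeasurable_of_tendsto_ae atTop hmeasn
      (ae_of_all _ fun θ => hlim _ (hmem θ))
  have hhL : ∀ z ∈ Metric.closedBall c R, |h z| ≤ L := fun z hz =>
    le_of_tendsto (hlim z hz).abs (Eventually.of_forall fun n => hL n z hz)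
  have hI : CircleIntegrable h c R := by
    rw [CircleIntegrable, intervalIntegrable_iff]
    refine Integrable.mono' (g := fun _ => L) (intervalIntegrable_iff.1 intervalIntegrable_const) hmeas ?_
    exact ae_of_all _ fun θ => hhL _ (hmem θ)
  have hI0 : CircleIntegrable (fun z => h (z + c)) 0 R := by
    have : (fun θ => h (circleMap c R θ)) = fun θ => h (circleMap 0 R θ + c) := by
      ext θ; simp [circleMap, add_comm]
    rw [CircleIntegrable] at hI ⊢
    rwa [this] at hI
  have hI0C : CircleIntegrable (fun z => (h (z + c) : ℂ)) 0 R := by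
    rw [CircleIntegrable, intervalIntegrable_iff] at hI0 ⊢
    exact Complex.ofRealCLM.integrable_comp hI0
  refine ⟨fun w => Real.circleAverage
    (fun ζ ↦ herglotzRieszKernel 0 (w - c) ζ • (h (ζ + c) : ℂ)) 0 R, ?_, ?_⟩
  · have := differentiableOn_circleAverage_herglotzRieszKernel_smul hI0C
    refine this.comp (g := fun w => Real.circleAverage
      (fun ζ ↦ herglotzRieszKernel 0 w ζ • (h (ζ + c) : ℂ)) 0 R) (f := fun w => w - c)
      (by fun_prop) ?_
    intro w hw
    simpa [dist_eq_norm] using hw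
  · intro w hw
    have hw0 : w - c ∈ Metric.ball (0 : ℂ) R := by simpa [dist_eq_norm] using hw
    rw [re_circleAverage_herglotzRieszKernel_smul (g := fun ζ => h (ζ + c)) hI0 hw0]
    have hk : ContinuousOn (Complex.re ∘ herglotzRieszKernel c w) (Metric.sphere c |R|) :=
      Complex.continuous_re.comp_continuousOn (continuousOn_herglotzRieszKernel_sphere hw)
    have e : Real.circleAverage ((Complex.re ∘ herglotzRieszKernel 0 (w - c)) •
        fun ζ => h (ζ + c)) 0 R
        = Real.circleAverage ((Complex.re ∘ herglotzRieszKernel c w) • h) c R := by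
      rw [← Real.circleAverage_map_add_const (c := c)]
      congr 1
      ext z
      simp [herglotzRieszKernel_add_const]
    rw [e]
    have hP := fun n => (hu n).circleAverage_re_herglotzRieszKernel_smul hw
    have hwc : w ∈ Metric.closedBall c R := Metric.ball_subset_closedBall hw
    refine tendsto_nhds_unique (hlim w hwc) ?_
    simp_rw [← hP]
    unfold Real.circleAverage
    refine Tendsto.const_smul ?_ _
    obtain ⟨K, hK⟩ := (isCompact_sphere c |R|).exists_bound_of_continuousOn hk
    refine intervalIntegral.tendsto_integral_filter_of_dominated_convergence
      (fun _ => K * L) ?_ ?_ ?_ ?_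
    · refine Eventually.of_forall fun n => ?_
      exact (intervalIntegrable_iff.1 (hk.smul (hcontn n)).circleIntegrable').aestronglyMeasurable
    · refine Eventually.of_forall fun n => ae_of_all _ fun θ _ => ?_
      simp only [Pi.smul_apply', smul_eq_mul, norm_mul]
      have h1 := hK _ (circleMap_mem_sphere' c R θ)
      exact mul_le_mul h1 (hL n _ (hmem θ)) (norm_nonneg _) ((norm_nonneg _).trans h1)
    · exact intervalIntegrable_const
    · exact ae_of_all _ fun θ _ => (hlim _ (hmem θ)).const_mul
        ((herglotzRieszKernel c w (circleMap c R θ)).re)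

/-- **Key analytic step in the proof of Proposition 10.1.** If `φ : D × [0,1] → ℝ` is
harmonic in the first variable, monotone in the second, and Lipschitz on `E × [0,1]` for
every compact `E ⊆ D` (`D ⊆ ℂ` connected open), then for a.e. `t ∈ [0,1]` the transversal
derivative `∂φ/∂t(·,t)` exists a.e. on `D` and agrees a.e. on `D` with a nonnegative
harmonic function. -/
theorem transversal_derivative_is_harmonic
    (D : Set ℂ) (hD_open : IsOpen D) (hD_conn : IsConnected D)
    (φ : ℂ → ℝ → ℝ)
    (hharm : ∀ t ∈ Icc (0 : ℝ) 1, HarmonicOnSet (fun z => φ z t) D)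
    (hmono : ∀ s ∈ Icc (0 : ℝ) 1, ∀ t ∈ Icc (0 : ℝ) 1, s ≤ t →
      ∀ z ∈ D, φ z s ≤ φ z t)
    (hlip : ∀ E : Set ℂ, E ⊆ D → IsCompact E → ∃ L : NNReal,
      LipschitzOnWith L (fun p : ℂ × ℝ => φ p.1 p.2) (E ×ˢ Icc (0 : ℝ) 1)) :
    ∀ᵐ t ∂(volume.restrict (Icc (0 : ℝ) 1)),
      ∃ h : ℂ → ℝ, HarmonicOnSet h D ∧ (∀ z ∈ D, 0 ≤ h z) ∧
        ∀ᵐ z ∂(volume.restrict D), HasDerivAt (fun s => φ z s) (h z) t := by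
  -- countable dense set
  obtain ⟨Q, hQD, hQc, hQd⟩ := TopologicalSpace.IsSeparable.exists_countable_dense_subset
    (TopologicalSpace.IsSeparable.of_separableSpace D)
  have hae : ∀ᵐ t : ℝ, ∀ q ∈ Q, t ∈ Icc (0 : ℝ) 1 →
      DifferentiableWithinAt ℝ (φ q) (Icc 0 1) t := by
    rw [ae_ball_iff hQc]
    intro q hq
    refine MonotoneOn.ae_differentiableWithinAt_of_mem ?_
    intro s hs t ht hst
    exact hmono s hs t ht hst q (hQD hq)
  have hne0 : ∀ᵐ t : ℝ, t ≠ 0 := Measure.ae_ne volume 0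
  have hne1 : ∀ᵐ t : ℝ, t ≠ 1 := Measure.ae_ne volume 1
  rw [ae_restrict_iff' measurableSet_Icc]
  filter_upwards [hae, hne0, hne1] with t ht ht0 ht1 htI
  have hIn : Icc (0 : ℝ) 1 ∈ nhds t :=
    Icc_mem_nhds (lt_of_le_of_ne htI.1 ht0.symm) (lt_of_le_of_ne htI.2 ht1)
  have hev : ∀ᶠ s in nhdsWithin t {t}ᶜ, s ∈ Icc (0 : ℝ) 1 := nhdsWithin_le_nhds hIn
  -- properties of difference quotients
  have hnonneg : ∀ s ∈ Icc (0 : ℝ) 1, ∀ z ∈ D, 0 ≤ slope (φ z) t s := by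
    intro s hs z hz
    rw [slope_def_field]
    rcases le_total s t with hst | hst
    · exact div_nonneg_of_nonpos (by linarith [hmono s hs t htI hst z hz]) (by linarith)
    · exact div_nonneg (by linarith [hmono t htI s hs hst z hz]) (by linarith)
  have hharmS : ∀ s ∈ Icc (0 : ℝ) 1, InnerProductSpace.HarmonicOnNhd
      (fun z => slope (φ z) t s) D := by
    intro s hs
    have h1 := ((hharm s hs).harmonicOnNhd.sub (hharm t htI).harmonicOnNhd).const_smul
      (c := (s - t)⁻¹)
    exact h1
  have hbound : ∀ E : Set ℂ, E ⊆ D → IsCompact E → ∃ L : ℝ, 0 ≤ L ∧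
      ∀ s ∈ Icc (0 : ℝ) 1, ∀ z ∈ E, |slope (φ z) t s| ≤ L := by
    intro E hE hEc
    obtain ⟨L, hL⟩ := hlip E hE hEc
    refine ⟨L, L.2, fun s hs z hz => ?_⟩
    have h1 := hL.dist_le_mul (z, s) ⟨hz, hs⟩ (z, t) ⟨hz, htI⟩
    rw [Real.dist_eq] at h1
    have h2 : dist ((z, s) : ℂ × ℝ) (z, t) = |s - t| := by
      simp [Prod.dist_eq, Real.dist_eq]
    rw [h2] at h1
    rw [slope_def_field, abs_div]
    exact div_le_of_le_mul₀ (abs_nonneg _) L.2 h1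
  have hderQ : ∀ q ∈ Q, ∃ l, Tendsto (slope (φ q) t) (nhdsWithin t {t}ᶜ) (nhds l) := by
    intro q hq
    have := ((ht q hq htI).differentiableAt hIn).hasDerivAt
    exact ⟨_, hasDerivAt_iff_tendsto_slope.1 this⟩
  have hder : ∀ z ∈ D, ∃ l, Tendsto (slope (φ z) t) (nhdsWithin t {t}ᶜ) (nhds l) := by
    intro z hz
    obtain ⟨R, hR, hRD⟩ := Metric.nhds_basis_closedBall.mem_iff.1 (hD_open.mem_nhds hz)
    obtain ⟨L, hL0, hL⟩ := hbound _ hRD (isCompact_closedBall z R)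
    refine cauchy_map_iff_exists_tendsto.1 ?_
    rw [Metric.cauchy_iff]
    refine ⟨inferInstance, fun ε hε => ?_⟩
    -- find a good nearby point
    have hsmall : Tendsto (fun w : ℂ => 2 * ‖w - z‖ / (R - ‖w - z‖) * L) (nhds z) (nhds 0) := by
      have : ContinuousAt (fun w : ℂ => 2 * ‖w - z‖ / (R - ‖w - z‖) * L) z := by
        refine ContinuousAt.mul (ContinuousAt.div (by fun_prop) (by fun_prop) ?_) (by fun_prop)
        simpa using hR.ne'
      simpa [ContinuousAt] using this
    have hnear : ∀ᶠ w in nhds z, 2 * ‖w - z‖ / (R - ‖w - z‖) * L < ε / 4 ∧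
        w ∈ Metric.ball z R :=
      (hsmall.eventually (gt_mem_nhds (by positivity))).and (Metric.ball_mem_nhds z hR)
    obtain ⟨q, ⟨hq1, hq2⟩, hqQ⟩ := mem_closure_iff_nhds.1 (hQd hz) _ hnear
    obtain ⟨l, hl⟩ := hderQ q hqQ
    have hlq : ∀ᶠ s in nhdsWithin t {t}ᶜ, |slope (φ q) t s - l| < ε / 4 := by
      have := Metric.tendsto_nhds.1 hl (ε / 4) (by positivity)
      simpa [Real.dist_eq] using this
    refine ⟨_, image_mem_map (hlq.and hev), ?_⟩
    have hclose : ∀ s ∈ Icc (0 : ℝ) 1, |slope (φ q) t s - slope (φ z) t s| < ε / 4 := by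
      intro s hs
      refine lt_of_le_of_lt (harnack_bound (u := fun z => slope (φ z) t s)
        ((hharmS s hs).mono hRD) (fun w hw => hnonneg s hs w (hRD hw)) ?_ hq2) hq1
      exact (le_abs_self _).trans (hL s hs z (Metric.mem_closedBall_self hR.le))
    rintro _ ⟨s, ⟨hs1, hs2⟩, rfl⟩ _ ⟨s', ⟨hs1', hs2'⟩, rfl⟩
    have a1 := abs_lt.1 (hclose s hs2)
    have a2 := abs_lt.1 (hclose s' hs2')
    have a3 := abs_lt.1 hs1
    have a4 := abs_lt.1 hs1'
    rw [Real.dist_eq, abs_lt]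
    constructor <;> linarith
  choose! h hh using hder
  have hnon : ∀ z ∈ D, 0 ≤ h z := by
    intro z hz
    exact ge_of_tendsto (hh z hz) (hev.mono fun s hs => hnonneg s hs z hz)
  refine ⟨h, ?_, hnon, ?_⟩
  · intro c hc
    obtain ⟨R, hR, hRD⟩ := Metric.nhds_basis_closedBall.mem_iff.1 (hD_open.mem_nhds hc)
    obtain ⟨L, hL0, hL⟩ := hbound _ hRD (isCompact_closedBall c R)
    obtain ⟨x, hx⟩ := exists_seq_tendsto (nhdsWithin t {t}ᶜ)
    obtain ⟨N, hN⟩ := eventually_atTop.1 (hx.eventually hev)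
    have hx' := (tendsto_add_atTop_iff_nat N).2 hx
    have hxI : ∀ n, x (n + N) ∈ Icc (0 : ℝ) 1 := fun n => hN _ (by omega)
    refine ⟨R, hR, Metric.ball_subset_closedBall.trans hRD, ?_⟩
    exact limit_re (u := fun n z => slope (φ z) t (x (n + N))) hR
      (fun n => (hharmS _ (hxI n)).mono hRD) (fun n z hz => hL _ (hxI n) z hz)
      (fun z hz => (hh z (hRD hz)).comp hx')
  · refine (ae_restrict_iff' hD_open.measurableSet).2 (ae_of_all _ fun z hz => ?_)
    exact hasDerivAt_iff_tendsto_slope.2 (hh z hz)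
end
end
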